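/- arXiv:2011.04255 — 3 statements merged into one kernel-verified Lean document; each statement's English description precedes it below -/
import Mathlib

section
/- Let T be a maximal outerplanar graph of order 5 with boundary cycle C = (u_1, ..., u_5, u_1). Then for every vertex u_i of T, there exists a total dominating set of T of size 2 that contains u_i. -/
/-!
Common definitions.

A *plane graph* is a finite graph whose vertices are points of the plane `ℝ × ℝ` and whose
edges are drawn as straight-line segments between their endpoints (by Fáry's theorem every
planar graph admits such a drawing).  A *near-triangulation* is a plane graph that is properly
embedded, biconnected, and all of whose bounded faces are triangles (the faces are the
connected components of the complement of the drawing).  The boundary cycle lists, cyclically,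
the vertices on the outer (unbounded) face.
-/

open scoped Classical

noncomputable section

/-- A finite graph drawn in the plane: the vertices are points of `ℝ × ℝ` and each edge is
drawn as the straight-line segment between its endpoints. -/
structure PlaneGraph where
  verts : Finset (ℝ × ℝ)
  Adj : ℝ × ℝ → ℝ × ℝ → Prop
  symm : ∀ p q, Adj p q → Adj q p
  loopless : ∀ p, ¬ Adj p p
  mem_of_adj : ∀ p q, Adj p q → p ∈ verts ∧ q ∈ verts

namespace PlaneGraph

variable (G : PlaneGraph)

/-- The union of the (closed) segments realizing the edges of the graph. -/
def drawing : Set (ℝ × ℝ) := {x | ∃ p q, G.Adj p q ∧ x ∈ segment ℝ p q}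

/-- The straight-line drawing is a proper plane embedding: two edges meet only in common
endpoints and no vertex lies on an edge of which it is not an endpoint. -/
def IsEmbedded : Prop :=
  (∀ p q r s, G.Adj p q → G.Adj r s → ∀ x, x ∈ segment ℝ p q → x ∈ segment ℝ r s →
      ({p, q} : Set (ℝ × ℝ)) = {r, s} ∨
        (x ∈ ({p, q} : Set (ℝ × ℝ)) ∧ x ∈ ({r, s} : Set (ℝ × ℝ)))) ∧
  (∀ p q v, G.Adj p q → v ∈ G.verts → v ∈ segment ℝ p q → v = p ∨ v = q)

/-- Reachability by walks in the graph. -/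
def Reachable (p q : ℝ × ℝ) : Prop := Relation.ReflTransGen G.Adj p q

/-- The graph is connected. -/
def Connected : Prop := G.verts.Nonempty ∧ ∀ p ∈ G.verts, ∀ q ∈ G.verts, G.Reachable p q

/-- Deletion of a set of vertices together with all incident edges. -/
def deleteVerts (S : Finset (ℝ × ℝ)) : PlaneGraph where
  verts := G.verts \ S
  Adj := fun p q => G.Adj p q ∧ p ∉ S ∧ q ∉ S
  symm := fun p q h => ⟨G.symm p q h.1, h.2.2, h.2.1⟩
  loopless := fun p h => G.loopless p h.1
  mem_of_adj := fun p q h => by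
    obtain ⟨h1, h2⟩ := G.mem_of_adj p q h.1
    exact ⟨Finset.mem_sdiff.mpr ⟨h1, h.2.1⟩, Finset.mem_sdiff.mpr ⟨h2, h.2.2⟩⟩

/-- Deletion of a single edge (keeping all vertices). -/
def deleteEdge (p q : ℝ × ℝ) : PlaneGraph where
  verts := G.verts
  Adj := fun a b => G.Adj a b ∧ ¬ ((a = p ∧ b = q) ∨ (a = q ∧ b = p))
  symm := fun a b h => ⟨G.symm a b h.1, by tauto⟩
  loopless := fun a h => G.loopless a h.1
  mem_of_adj := fun a b h => G.mem_of_adj a b h.1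

/-- The (abstract, simple) graph obtained by contracting the edge `(p, q)`:
the vertex `q` is merged into `p`, which becomes the new contracted vertex. -/
def contractEdge (p q : ℝ × ℝ) : PlaneGraph where
  verts := G.verts.erase q
  Adj := fun a b =>
    a ≠ b ∧ a ∈ G.verts.erase q ∧ b ∈ G.verts.erase q ∧
      (G.Adj a b ∨ (a = p ∧ G.Adj q b) ∨ (b = p ∧ G.Adj q a))
  symm := fun a b h => by
    obtain ⟨h1, h2, h3, h4⟩ := h
    refine ⟨h1.symm, h3, h2, ?_⟩
    rcases h4 with h4 | h4 | h4
    · exact Or.inl (G.symm _ _ h4)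
    · exact Or.inr (Or.inr h4)
    · exact Or.inr (Or.inl h4)
  loopless := fun a h => h.1 rfl
  mem_of_adj := fun a b h => ⟨h.2.1, h.2.2.1⟩

/-- Biconnectivity: at least three vertices, connected, and deleting any single vertex leaves
a connected graph. -/
def Biconnected : Prop :=
  3 ≤ G.verts.card ∧ G.Connected ∧ ∀ v ∈ G.verts, (G.deleteVerts {v}).Connected

/-- A face of the plane graph: a connected component of the complement of the drawing. -/
def IsFace (F : Set (ℝ × ℝ)) : Prop :=
  ∃ x, x ∉ G.drawing ∧ F = connectedComponentIn G.drawingᶜ x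

/-- The open triangle with the three given corners. -/
def openTriangle (a b c : ℝ × ℝ) : Set (ℝ × ℝ) :=
  interior (convexHull ℝ ({a, b, c} : Set (ℝ × ℝ)))

/-- Every bounded (inner) face of the drawing is a triangular face of the graph. -/
def InnerFacesTriangles : Prop :=
  ∀ F, G.IsFace F → Bornology.IsBounded F →
    ∃ a ∈ G.verts, ∃ b ∈ G.verts, ∃ c ∈ G.verts,
      G.Adj a b ∧ G.Adj b c ∧ G.Adj a c ∧ F = openTriangle a b c

/-- A near-triangulation: a properly embedded biconnected plane graph all of whose faces are
triangles, except possibly the outer (unbounded) face. -/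
def IsNearTriangulation : Prop :=
  G.IsEmbedded ∧ G.Biconnected ∧ G.InnerFacesTriangles

/-- The outer region: the union of the unbounded components of the complement of the
drawing (for a near-triangulation this is the outer face). -/
def outerRegion : Set (ℝ × ℝ) :=
  {x | x ∉ G.drawing ∧ ¬ Bornology.IsBounded (connectedComponentIn G.drawingᶜ x)}

/-- `u : ZMod h → ℝ × ℝ` is the boundary cycle of `G`: an injective cyclic sequence
`u 0, u 1, …, u (h-1)` of vertices, consecutive ones adjacent, whose edges bound the outer
face and which contains every vertex lying on the boundary of the outer face. -/
def IsBoundaryCycle {h : ℕ} (u : ZMod h → ℝ × ℝ) : Prop :=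
  3 ≤ h ∧ Function.Injective u ∧
  (∀ i, u i ∈ G.verts) ∧
  (∀ i, G.Adj (u i) (u (i + 1))) ∧
  (∀ i, segment ℝ (u i) (u (i + 1)) ⊆ frontier G.outerRegion) ∧
  (∀ v ∈ G.verts, (v : ℝ × ℝ) ∈ frontier G.outerRegion → v ∈ Set.range u)

/-- An interior vertex: a vertex not on the boundary cycle. -/
def IsInteriorVtx {h : ℕ} (u : ZMod h → ℝ × ℝ) (v : ℝ × ℝ) : Prop :=
  v ∈ G.verts ∧ v ∉ Set.range u

/-- The edge `(p, q)` is a diagonal: it joins two non-consecutive boundary vertices. -/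
def IsDiagonalEdge {h : ℕ} (u : ZMod h → ℝ × ℝ) (p q : ℝ × ℝ) : Prop :=
  G.Adj p q ∧ ∃ i j : ZMod h, p = u i ∧ q = u j ∧ j ≠ i + 1 ∧ i ≠ j + 1

/-- The graph has no diagonals: any edge between boundary vertices joins consecutive ones. -/
def HasNoDiagonals {h : ℕ} (u : ZMod h → ℝ × ℝ) : Prop :=
  ∀ i j : ZMod h, G.Adj (u i) (u j) → j = i + 1 ∨ i = j + 1

/-- The degree of a vertex. -/
def degree (v : ℝ × ℝ) : ℕ := (G.verts.filter (fun w => G.Adj v w)).card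

/-- The degree of a vertex in the subgraph induced on the set `S` of vertices. -/
def degreeOn (S : Set (ℝ × ℝ)) (v : ℝ × ℝ) : ℕ :=
  (G.verts.filter (fun w => G.Adj v w ∧ w ∈ S)).card

/-- A total dominating set: every vertex of the graph is adjacent to a member of `D`. -/
def IsTDS (D : Finset (ℝ × ℝ)) : Prop :=
  D ⊆ G.verts ∧ ∀ v ∈ G.verts, ∃ d ∈ D, G.Adj v d

/-- The total domination number `γₜ`. -/
def totalDominationNumber : ℕ :=
  sInf {k | ∃ D : Finset (ℝ × ℝ), G.IsTDS D ∧ D.card = k}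

/-- Isomorphism of plane graphs as abstract graphs. -/
def IsIsoTo (H : PlaneGraph) : Prop :=
  ∃ f : ℝ × ℝ → ℝ × ℝ,
    Set.BijOn f (↑G.verts) (↑H.verts) ∧
    ∀ p ∈ G.verts, ∀ q ∈ G.verts, (G.Adj p q ↔ H.Adj (f p) (f q))

/-- The edge `(p, q)` is contractible: the contracted graph `G/e` is (abstractly isomorphic
to) a near-triangulation. -/
def IsContractible (p q : ℝ × ℝ) : Prop :=
  G.Adj p q ∧ ∃ H : PlaneGraph, H.IsNearTriangulation ∧ (G.contractEdge p q).IsIsoTo H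

/-- A separating triangle: a triangle of the graph with some vertex strictly inside it and
some vertex outside it. -/
def IsSeparatingTriangle (a b c : ℝ × ℝ) : Prop :=
  a ∈ G.verts ∧ b ∈ G.verts ∧ c ∈ G.verts ∧
  G.Adj a b ∧ G.Adj b c ∧ G.Adj a c ∧
  (∃ v ∈ G.verts, v ∈ openTriangle a b c) ∧
  (∃ v ∈ G.verts, v ∉ convexHull ℝ ({a, b, c} : Set (ℝ × ℝ)))

/-- Edge list of the first exceptional 12-vertex maximal outerplanar graph `H₁`
(boundary 12-cycle, central triangle `{0,4,8}`, ear triangles `{1,2,3}`, `{5,6,7}`,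
`{9,10,11}`, and the three remaining quadrilateral diagonals, all with the same
orientation). -/
def exc1Edges : List (Fin 12 × Fin 12) :=
  [(0,1),(1,2),(2,3),(3,4),(4,5),(5,6),(6,7),(7,8),(8,9),(9,10),(10,11),(11,0),
   (0,4),(4,8),(0,8),(1,3),(5,7),(9,11),(0,3),(4,7),(8,11)]

/-- Edge list of the second exceptional 12-vertex maximal outerplanar graph `H₂`
(same as `H₁` except that one quadrilateral diagonal has the opposite orientation). -/
def exc2Edges : List (Fin 12 × Fin 12) :=
  [(0,1),(1,2),(2,3),(3,4),(4,5),(5,6),(6,7),(7,8),(8,9),(9,10),(10,11),(11,0),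
   (0,4),(4,8),(0,8),(1,3),(5,7),(9,11),(0,3),(4,7),(0,9)]

/-- The exceptional graph `H₁`. -/
def H1graph : SimpleGraph (Fin 12) := SimpleGraph.fromRel (fun a b => (a, b) ∈ exc1Edges)

/-- The exceptional graph `H₂`. -/
def H2graph : SimpleGraph (Fin 12) := SimpleGraph.fromRel (fun a b => (a, b) ∈ exc2Edges)

/-- Isomorphism between a plane graph and a simple graph on `Fin 12`. -/
def IsIsoToSG (H : SimpleGraph (Fin 12)) : Prop :=
  ∃ f : ℝ × ℝ → Fin 12,
    Set.BijOn f (↑G.verts) Set.univ ∧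
    ∀ p ∈ G.verts, ∀ q ∈ G.verts, (G.Adj p q ↔ H.Adj (f p) (f q))

/-- `G` is isomorphic to `H₁` or to `H₂`. -/
def IsExceptional : Prop := G.IsIsoToSG H1graph ∨ G.IsIsoToSG H2graph

/-- A maximal outerplanar graph (MOP): a near-triangulation all of whose vertices lie on the
boundary cycle. -/
def IsMOP : Prop :=
  G.IsNearTriangulation ∧
    ∃ (h : ℕ) (u : ZMod h → ℝ × ℝ), G.IsBoundaryCycle u ∧ ∀ v ∈ G.verts, v ∈ Set.range u

/-- The graph is Hamiltonian: it has a cycle through all of its vertices. -/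
def IsHamiltonian : Prop :=
  ∃ (m : ℕ) (c : ZMod m → ℝ × ℝ), 3 ≤ m ∧ Function.Injective c ∧
    (∀ i, G.Adj (c i) (c (i + 1))) ∧ ∀ v ∈ G.verts, v ∈ Set.range c

/-- An outerplane graph: a properly embedded plane graph all of whose vertices lie on the
boundary of the outer region. -/
def IsOuterplane : Prop :=
  G.IsEmbedded ∧ ∀ v ∈ G.verts, (v : ℝ × ℝ) ∈ closure G.outerRegion

/-- The union of the boundary-cycle segments. -/
def boundaryDrawing {h : ℕ} (u : ZMod h → ℝ × ℝ) : Set (ℝ × ℝ) :=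
  ⋃ i : ZMod h, segment ℝ (u i) (u (i + 1))

/-- The open interior of the boundary cycle, viewed as a simple closed polygon. -/
def polygonInterior {h : ℕ} (u : ZMod h → ℝ × ℝ) : Set (ℝ × ℝ) :=
  {x | x ∉ boundaryDrawing u ∧
    Bornology.IsBounded (connectedComponentIn (boundaryDrawing u)ᶜ x)}

/-- The union of the segments realizing the diagonals of `G[C]`. -/
def diagonalDrawing {h : ℕ} (u : ZMod h → ℝ × ℝ) : Set (ℝ × ℝ) :=
  {x | ∃ i j : ZMod h, G.Adj (u i) (u j) ∧ j ≠ i + 1 ∧ i ≠ j + 1 ∧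
    x ∈ segment ℝ (u i) (u j)}

/-- A region of the subdivision of the interior of the boundary cycle by the diagonals of
`G[C]`: a connected component of the interior of the cycle minus the diagonals. -/
def IsSubdivisionRegion {h : ℕ} (u : ZMod h → ℝ × ℝ) (R : Set (ℝ × ℝ)) : Prop :=
  ∃ x ∈ polygonInterior u \ G.diagonalDrawing u,
    R = connectedComponentIn (polygonInterior u \ G.diagonalDrawing u) x

/-- The diagonal `(u i, u j)` is a side of the region `R`. -/
def IsSideOf {h : ℕ} (u : ZMod h → ℝ × ℝ) (R : Set (ℝ × ℝ)) (i j : ZMod h) : Prop :=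
  G.Adj (u i) (u j) ∧ j ≠ i + 1 ∧ i ≠ j + 1 ∧
    segment ℝ (u i) (u j) \ {u i, u j} ⊆ frontier R

/-- `v` lies on the opposite side of the diagonal `(u i, u j)` from the region `R`:
inside the boundary polygon, `v` cannot be joined to `R` without crossing the diagonal. -/
def OppositeSideOf {h : ℕ} (u : ZMod h → ℝ × ℝ) (R : Set (ℝ × ℝ)) (i j : ZMod h)
    (v : ℝ × ℝ) : Prop :=
  ∀ x ∈ R, v ∉ connectedComponentIn (polygonInterior u \ segment ℝ (u i) (u j)) x

/-- A terminal polygon: a region of the subdivision containing some interior vertex such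
that at most one of its sides has interior vertices of `G` on its opposite side
(i.e. at most one of the outer parts `T_out(P,d)` contains interior vertices). -/
def IsTerminalPolygon {h : ℕ} (u : ZMod h → ℝ × ℝ) (R : Set (ℝ × ℝ)) : Prop :=
  G.IsSubdivisionRegion u R ∧
  (∃ v, G.IsInteriorVtx u v ∧ v ∈ R) ∧
  ∀ i j k l : ZMod h,
    G.IsSideOf u R i j → G.IsSideOf u R k l →
    (∃ w, G.IsInteriorVtx u w ∧ OppositeSideOf u R i j w) →
    (∃ w, G.IsInteriorVtx u w ∧ OppositeSideOf u R k l w) →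
    ({u i, u j} : Set (ℝ × ℝ)) = {u k, u l}

/-- An irreducible near-triangulation: it has interior vertices, and for every boundary edge
`(u i, u (i+1))` the third vertex of the inner triangular face containing this edge also lies
on the boundary cycle. -/
def Irreducible {h : ℕ} (u : ZMod h → ℝ × ℝ) : Prop :=
  (∃ v, G.IsInteriorVtx u v) ∧
  ∀ i : ZMod h, ∀ v ∈ G.verts,
    G.Adj (u i) v → G.Adj (u (i + 1)) v →
    G.IsFace (openTriangle (u i) (u (i + 1)) v) → v ∈ Set.range u

end PlaneGraph

/-- A point of a triangle with non-empty interior that is not an interior point lies on a side. -/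
theorem mem_segment_of_mem_convexHull_triple {E : Type*} [AddCommGroup E] [Module ℝ E]
    [TopologicalSpace E] [IsTopologicalAddGroup E] [ContinuousConstSMul ℝ E] {a b c x : E}
    (hne : (interior (convexHull ℝ {a, b, c})).Nonempty) (hx : x ∈ convexHull ℝ {a, b, c})
    (hxi : x ∉ interior (convexHull ℝ {a, b, c})) :
    x ∈ segment ℝ a b ∨ x ∈ segment ℝ b c ∨ x ∈ segment ℝ a c := by
  have hmem : ∀ y, y ∈ convexHull ℝ {a, b, c} ↔
      ∃ α β γ : ℝ, 0 ≤ α ∧ 0 ≤ β ∧ 0 ≤ γ ∧ α + β + γ = 1 ∧ α • a + β • b + γ • c = y := by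
    intro y
    constructor
    · intro hy
      rw [← convexJoin_segment_singleton, mem_convexJoin] at hy
      obtain ⟨z, ⟨s, t, hs, ht, hst, rfl⟩, c', hc', s', t', hs', ht', hst', rfl⟩ := hy
      rw [Set.mem_singleton_iff] at hc'
      subst hc'
      refine ⟨s' * s, s' * t, t', by positivity, by positivity, ht', ?_, ?_⟩
      · rw [← mul_add, hst, mul_one, hst']
      · simp [smul_add, mul_smul]
    · rintro ⟨α, β, γ, hα, hβ, hγ, hsum, rfl⟩
      have hconv := convex_convexHull ℝ ({a, b, c} : Set E)
      have hsub := subset_convexHull ℝ ({a, b, c} : Set E)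
      have := hconv.sum_mem (t := Finset.univ) (w := ![α, β, γ]) (z := ![a, b, c])
        (by intro i _; fin_cases i <;> simpa) (by simpa [Fin.sum_univ_three] using hsum)
        (by intro i _; apply hsub; fin_cases i <;> simp)
      simpa [Fin.sum_univ_three] using this
  obtain ⟨α, β, γ, hα, hβ, hγ, hsum, rfl⟩ := (hmem x).1 hx
  rcases hα.eq_or_lt with rfl | hα
  · exact Or.inr (Or.inl ⟨β, γ, hβ, hγ, by linarith, by simp⟩)
  rcases hβ.eq_or_lt with rfl | hβ
  · exact Or.inr (Or.inr ⟨α, γ, hα.le, hγ, by linarith, by simp⟩)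
  rcases hγ.eq_or_lt with rfl | hγ
  · exact Or.inl ⟨α, β, hα.le, hβ.le, by linarith, by simp⟩
  refine absurd ?_ hxi
  obtain ⟨y, hy⟩ := hne
  obtain ⟨α', β', γ', hα', hβ', hγ', hsum', rfl⟩ := (hmem y).1 (interior_subset hy)
  obtain ⟨t, ht, htα, htβ, htγ⟩ : ∃ t : ℝ, 0 < t ∧ t < α ∧ t < β ∧ t < γ :=
    ⟨min α (min β γ) / 2, by positivity,
      (half_lt_self (by positivity)).trans_le (min_le_left _ _),
      (half_lt_self (by positivity)).trans_le ((min_le_right _ _).trans (min_le_left _ _)),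
      (half_lt_self (by positivity)).trans_le ((min_le_right _ _).trans (min_le_right _ _))⟩
  have ht1 : 0 < 1 - t := by linarith
  have hz : (1 - t)⁻¹ • ((α - t * α') • a + (β - t * β') • b + (γ - t * γ') • c) ∈
      convexHull ℝ {a, b, c} := by
    refine (hmem _).2 ⟨(1 - t)⁻¹ * (α - t * α'), (1 - t)⁻¹ * (β - t * β'),
      (1 - t)⁻¹ * (γ - t * γ'), ?_, ?_, ?_, ?_, ?_⟩
    · exact mul_nonneg (by positivity) (by nlinarith)
    · exact mul_nonneg (by positivity) (by nlinarith)
    · exact mul_nonneg (by positivity) (by nlinarith)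
    · field_simp
      linear_combination hsum - t * hsum'
    · simp [smul_add, mul_smul]
  refine (convex_convexHull ℝ _).openSegment_interior_closure_subset_interior hy
    (subset_closure hz) ⟨t, 1 - t, ht, ht1, by ring, ?_⟩
  rw [smul_smul, mul_inv_cancel₀ ht1.ne', one_smul]
  module

namespace Complex

open Filter Topology

theorem sub_div_sub_mem_slitPlane {p q w : ℂ} (h : w ∉ segment ℝ p q) :
    (q - w) / (p - w) ∈ slitPlane := by
  have hp : p - w ≠ 0 := fun h0 => h (by rw [← sub_eq_zero.1 h0]; exact left_mem_segment ℝ p q)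
  rw [mem_slitPlane_iff_not_le_zero]
  intro hle
  obtain ⟨hre, him⟩ := Complex.le_def.1 hle
  set r := (q - w) / (p - w) with hr
  have hreal : r = (r.re : ℂ) := by
    apply Complex.ext <;> simp_all
  have hmul : q - w = (r.re : ℂ) * (p - w) := by rw [← hreal, hr, div_mul_cancel₀ _ hp]
  simp only [zero_re] at hre
  generalize r.re = t at hre hmul
  have ht : (0 : ℝ) < 1 - t := by linarith
  have ht' : (1 - t : ℂ) ≠ 0 := by exact_mod_cast ht.ne'
  refine h ⟨-t / (1 - t), 1 / (1 - t), div_nonneg (by linarith) ht.le, by positivity, ?_, ?_⟩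
  · field_simp
    ring
  · simp only [real_smul]
    push_cast
    field_simp
    linear_combination hmul

/-- The change of argument of a closed polygon around a point, as a sum of principal logarithms:
off the polygon it is `2 * π * I` times the winding number. -/
def polygonLogSum {h : ℕ} [NeZero h] (v : ZMod h → ℂ) (w : ℂ) : ℂ :=
  ∑ k, log ((v (k + 1) - w) / (v k - w))

variable {h : ℕ} [NeZero h] {v : ZMod h → ℂ} {w : ℂ}

theorem continuousAt_log_sub_div_sub {p q w : ℂ} (h : w ∉ segment ℝ p q) :
    ContinuousAt (fun z => log ((q - z) / (p - z))) w := by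
  have hp : p - w ≠ 0 := fun h0 => h (by rw [← sub_eq_zero.1 h0]; exact left_mem_segment ℝ p q)
  refine ContinuousAt.clog ?_ (sub_div_sub_mem_slitPlane h)
  exact (continuousAt_const.sub continuousAt_id).div (continuousAt_const.sub continuousAt_id) hp

theorem exp_polygonLogSum (hw : ∀ k, w ∉ segment ℝ (v k) (v (k + 1))) :
    exp (polygonLogSum v w) = 1 := by
  have hne : ∀ k, v k - w ≠ 0 := fun k h0 =>
    hw k (by rw [← sub_eq_zero.1 h0]; exact left_mem_segment ℝ _ _)
  rw [polygonLogSum, exp_sum]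
  simp_rw [fun k => exp_log (div_ne_zero (hne (k + 1)) (hne k)), Finset.prod_div_distrib]
  have hshift : ∏ k, (v (k + 1) - w) = ∏ k, (v k - w) :=
    Fintype.prod_equiv (Equiv.addRight 1) _ _ fun k => rfl
  rw [hshift]
  exact div_self (Finset.prod_ne_zero_iff.2 fun k _ => hne k)

theorem eq_zero_of_exp_eq_one {z : ℂ} (hz : exp z = 1) (hnorm : ‖z‖ ≤ 1) : z = 0 := by
  obtain ⟨n, rfl⟩ := exp_eq_one_iff.1 hz
  rcases eq_or_ne n 0 with rfl | hn
  · simp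
  · have h1 : (1 : ℝ) ≤ |(n : ℝ)| := by exact_mod_cast Int.one_le_abs hn
    have h2 : ‖(n : ℂ) * (2 * Real.pi * I)‖ = |(n : ℝ)| * (2 * Real.pi) := by
      simp [abs_of_pos Real.pi_pos]
    rw [h2] at hnorm
    nlinarith [Real.pi_gt_three]

theorem tendsto_polygonLogSum_cobounded (v : ZMod h → ℂ) :
    Tendsto (polygonLogSum v) (Bornology.cobounded ℂ) (𝓝 0) := by
  have key : ∀ p q : ℂ, Tendsto (fun w => log ((q - w) / (p - w))) (Bornology.cobounded ℂ)
      (𝓝 0) := by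
    intro p q
    have hsub : Tendsto (fun w : ℂ => p - w) (Bornology.cobounded ℂ) (Bornology.cobounded ℂ) := by
      simp
    have hlim : Tendsto (fun w : ℂ => 1 + (q - p) * (p - w)⁻¹) (Bornology.cobounded ℂ) (𝓝 1) := by
      simpa using ((tendsto_inv₀_cobounded.comp hsub).const_mul (q - p)).const_add 1
    have hev : ∀ᶠ w : ℂ in Bornology.cobounded ℂ, 1 + (q - p) * (p - w)⁻¹ = (q - w) / (p - w) := by
      filter_upwards [Bornology.eventually_ne_cobounded p] with w hw
      have : p - w ≠ 0 := sub_ne_zero.2 hw.symm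
      field_simp
      ring
    have := (hlim.congr' hev).clog (by simp)
    simpa using this
  change Tendsto (fun w => ∑ k, log ((v (k + 1) - w) / (v k - w))) _ _
  simpa using tendsto_finsetSum Finset.univ fun k _ => key (v k) (v (k + 1))

/-- A polygon does not wind around the points of an unbounded connected set avoiding it. -/
theorem polygonLogSum_eq_zero {C : Set ℂ} (hC : IsPreconnected C)
    (hunb : ¬ Bornology.IsBounded C) (hav : ∀ z ∈ C, ∀ k, z ∉ segment ℝ (v k) (v (k + 1)))
    (hw : w ∈ C) : polygonLogSum v w = 0 := by
  obtain ⟨y, hyC, hy⟩ : ∃ y ∈ C, ‖polygonLogSum v y‖ < 1 := by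
    have hev : ∀ᶠ z in Bornology.cobounded ℂ, ‖polygonLogSum v z‖ < 1 :=
      (tendsto_polygonLogSum_cobounded v).norm.eventually_lt_const (by simp)
    by_contra! hcon
    refine hunb (Bornology.isBounded_def.2 ?_)
    filter_upwards [hev] with z hz hzC
    exact absurd hz (hcon z hzC).not_gt
  have hcont : ContinuousOn (fun z => ‖polygonLogSum v z‖) C := fun z hz =>
    (ContinuousAt.norm (tendsto_finsetSum _ fun k _ =>
      continuousAt_log_sub_div_sub (hav z hz k))).continuousWithinAt
  by_contra hne
  have h1 : 1 ≤ ‖polygonLogSum v w‖ := by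
    by_contra! hlt
    exact hne (eq_zero_of_exp_eq_one (exp_polygonLogSum (hav w hw)) hlt.le)
  obtain ⟨z, hzC, hz⟩ := hC.intermediate_value hyC hw hcont ⟨hy.le, h1⟩
  have := eq_zero_of_exp_eq_one (exp_polygonLogSum (hav z hzC)) (le_of_eq hz)
  simp [this] at hz

/-- The change of argument of a polygon jumps when crossing a side at its midpoint. -/
theorem eventually_polygonLogSum_ne {j : ZMod h} (hj : v j ≠ v (j + 1))
    (hm : ∀ k ≠ j, midpoint ℝ (v j) (v (j + 1)) ∉ segment ℝ (v k) (v (k + 1))) :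
    ∀ᶠ ε : ℝ in 𝓝[>] 0,
      polygonLogSum v (midpoint ℝ (v j) (v (j + 1)) + ε * (I * (v (j + 1) - v j))) ≠
      polygonLogSum v (midpoint ℝ (v j) (v (j + 1)) + (-ε : ℝ) * (I * (v (j + 1) - v j))) := by
  set m := midpoint ℝ (v j) (v (j + 1)) with hmdef
  set d := v (j + 1) - v j with hd
  have hd0 : d ≠ 0 := sub_ne_zero.2 hj.symm
  set R : ℂ → ℂ := fun w => ∑ k ∈ Finset.univ.erase j, log ((v (k + 1) - w) / (v k - w)) with hR
  have hsplit : ∀ w, polygonLogSum v w = log ((v (j + 1) - w) / (v j - w)) + R w := fun w =>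
    (Finset.add_sum_erase _ _ (Finset.mem_univ j)).symm
  have hRm : ContinuousAt R m := tendsto_finsetSum _ fun k hk =>
    continuousAt_log_sub_div_sub (hm k (Finset.ne_of_mem_erase hk))
  have hlim : ∀ s : ℝ, Tendsto (fun ε : ℝ => R (m + (s * ε : ℝ) * (I * d))) (𝓝[>] 0)
      (𝓝 (R m)) := fun s => by
    refine hRm.tendsto.comp (Tendsto.mono_left ?_ nhdsWithin_le_nhds)
    have : Continuous fun ε : ℝ => m + (s * ε : ℝ) * (I * d) := by fun_prop
    simpa using this.tendsto 0
  have hdiff : Tendsto (fun ε : ℝ => ‖R (m + (ε : ℝ) * (I * d)) - R (m + (-ε : ℝ) * (I * d))‖)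
      (𝓝[>] 0) (𝓝 0) := by
    simpa using ((hlim 1).sub (hlim (-1))).norm
  have hratio : ∀ ε : ℝ, (v (j + 1) - (m + ε * (I * d))) / (v j - (m + ε * (I * d))) =
      ((ε ^ 2 - 1 / 4) / (ε ^ 2 + 1 / 4) : ℝ) + (ε / (ε ^ 2 + 1 / 4) : ℝ) * I := by
    intro ε
    have hmid : m = (v j + v (j + 1)) / 2 := by
      rw [hmdef, midpoint_eq_smul_add]
      simp only [invOf_eq_inv, real_smul]
      push_cast
      ring
    have h1 : v (j + 1) - (m + ε * (I * d)) = d * (1 / 2 - ε * I) := by rw [hmid, hd]; ring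
    have h2 : v j - (m + ε * (I * d)) = d * (-1 / 2 - ε * I) := by rw [hmid, hd]; ring
    have h3 : (-1 / 2 - ε * I : ℂ) ≠ 0 := fun h0 => by
      have := congrArg re h0
      norm_num at this
    have h4 : ((ε : ℂ) ^ 2 + 1 / 4) ≠ 0 := by
      have : (0 : ℝ) < ε ^ 2 + 1 / 4 := by positivity
      simpa using ofReal_ne_zero.2 this.ne'
    rw [h1, h2, mul_div_mul_left _ _ hd0, div_eq_iff h3]
    push_cast
    rw [div_mul_eq_mul_div, ← add_div, div_mul_eq_mul_div, eq_div_iff h4]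
    ring_nf
    simp only [I_sq]
    ring
  have hsmall : ∀ᶠ ε : ℝ in 𝓝[>] 0, ε < 1 / 2 :=
    nhdsWithin_le_nhds (eventually_lt_nhds (by norm_num))
  filter_upwards [hdiff.eventually_lt_const one_pos, hsmall, self_mem_nhdsWithin] with ε h1 h2 h3 heq
  have h3 : 0 < ε := h3
  rw [hsplit, hsplit] at heq
  have him := congrArg im heq
  simp only [add_im, log_im] at him
  have hpos : Real.pi / 2 < arg ((v (j + 1) - (m + ε * (I * d))) / (v j - (m + ε * (I * d)))) := by
    rw [← not_le, arg_le_pi_div_two_iff, hratio]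
    simp only [add_re, ofReal_re, re_ofReal_mul, I_re, add_im, ofReal_im, im_ofReal_mul, I_im,
      mul_zero, add_zero, mul_one, zero_add, not_or, not_le, not_lt]
    exact ⟨div_neg_of_neg_of_pos (by nlinarith) (by positivity), by positivity⟩
  have hneg : arg ((v (j + 1) - (m + (-ε : ℝ) * (I * d))) / (v j - (m + (-ε : ℝ) * (I * d)))) <
      -(Real.pi / 2) := by
    rw [← not_le, neg_pi_div_two_le_arg_iff, hratio]
    simp only [add_re, ofReal_re, re_ofReal_mul, I_re, add_im, ofReal_im, im_ofReal_mul, I_im,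
      mul_zero, add_zero, mul_one, zero_add, not_or, not_le]
    exact ⟨div_neg_of_neg_of_pos (by nlinarith) (by positivity),
      div_neg_of_neg_of_pos (by linarith) (by positivity)⟩
  have hab := (abs_le.1 ((abs_im_le_norm _).trans h1.le)).1
  rw [sub_im] at hab
  linarith [Real.pi_gt_three]

end Complex

namespace PlaneGraph

open Filter Topology

variable {G : PlaneGraph}

/-- The straight-line drawing with some of the edges left out is a closed set. -/
theorem isClosed_subdrawing (P : ℝ × ℝ → ℝ × ℝ → Prop) :
    IsClosed {x | ∃ a b, G.Adj a b ∧ P a b ∧ x ∈ segment ℝ a b} := by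
  have heq : {x | ∃ a b, G.Adj a b ∧ P a b ∧ x ∈ segment ℝ a b} =
      ⋃ e ∈ {e : (ℝ × ℝ) × (ℝ × ℝ) | e ∈ G.verts ×ˢ G.verts ∧ G.Adj e.1 e.2 ∧ P e.1 e.2},
        segment ℝ e.1 e.2 := by
    ext x
    simp only [Set.mem_ofPred_eq, Set.mem_iUnion, Finset.mem_product, exists_prop]
    constructor
    · rintro ⟨a, b, hab, hP, hx⟩
      exact ⟨(a, b), ⟨G.mem_of_adj a b hab, hab, hP⟩, hx⟩
    · rintro ⟨⟨a, b⟩, ⟨-, hab, hP⟩, hx⟩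
      exact ⟨a, b, hab, hP, hx⟩
  rw [heq]
  refine ((G.verts ×ˢ G.verts).finite_toSet.subset fun e he => he.1).isClosed_biUnion
    fun e _ => ?_
  rw [← convexHull_pair]
  exact (Set.toFinite _).isClosed_convexHull ℝ

/-- The union of the bounded faces of the drawing. -/
def boundedRegion (G : PlaneGraph) : Set (ℝ × ℝ) :=
  {x | x ∉ G.drawing ∧ Bornology.IsBounded (connectedComponentIn G.drawingᶜ x)}

/-- A point in the closure of the inner faces that lies on the edge `p q`, but is not one of its
ends, lies on a side of an inner face; the third vertex of that face is adjacent to both ends. -/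
theorem exists_adj_adj_of_mem_closure_boundedRegion (hE : G.IsEmbedded)
    (hF : G.InnerFacesTriangles) {p q m : ℝ × ℝ} (hpq : G.Adj p q) (hm : m ∈ segment ℝ p q)
    (hmp : m ≠ p) (hmq : m ≠ q) (hcl : m ∈ closure G.boundedRegion) :
    ∃ r, G.Adj p r ∧ G.Adj q r := by
  let S : Set ((ℝ × ℝ) × (ℝ × ℝ) × (ℝ × ℝ)) :=
    {t | t ∈ G.verts ×ˢ G.verts ×ˢ G.verts ∧ (G.Adj t.1 t.2.1 ∧ G.Adj t.2.1 t.2.2 ∧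
      G.Adj t.1 t.2.2) ∧ openTriangle t.1 t.2.1 t.2.2 ⊆ G.drawingᶜ ∧
      (openTriangle t.1 t.2.1 t.2.2).Nonempty}
  have hS : S.Finite :=
    (G.verts ×ˢ G.verts ×ˢ G.verts).finite_toSet.subset fun t ht => ht.1
  have hsub : G.boundedRegion ⊆ ⋃ t ∈ S, openTriangle t.1 t.2.1 t.2.2 := by
    rintro x ⟨hx, hbdd⟩
    have hxmem := mem_connectedComponentIn (F := G.drawingᶜ) hx
    obtain ⟨a, ha, b, hb, c, hc, hab, hbc, hac, hFace⟩ := hF _ ⟨x, hx, rfl⟩ hbdd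
    rw [hFace] at hxmem
    refine Set.mem_biUnion (x := (a, b, c)) ⟨?_, ⟨hab, hbc, hac⟩, ?_, x, hxmem⟩ hxmem
    · simp [ha, hb, hc]
    · rw [← hFace]
      exact connectedComponentIn_subset _ _
  have hmS := closure_mono hsub hcl
  rw [hS.closure_biUnion] at hmS
  obtain ⟨⟨a, b, c⟩, ⟨-, ⟨hab, hbc, hac⟩, hdisj, hne⟩, hmt⟩ := Set.mem_iUnion₂.1 hmS
  have hhull : m ∈ convexHull ℝ {a, b, c} :=
    closure_minimal interior_subset ((Set.toFinite _).isClosed_convexHull ℝ) hmt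
  have hint : m ∉ interior (convexHull ℝ {a, b, c}) := fun h =>
    hdisj h ⟨p, q, hpq, hm⟩
  have hside : ∀ x y z, G.Adj x y → G.Adj x z → G.Adj y z → m ∈ segment ℝ x y →
      ∃ r, G.Adj p r ∧ G.Adj q r := by
    intro x y z hxy hxz hyz hmxy
    rcases hE.1 p q x y hpq hxy m hm hmxy with heq | ⟨h, -⟩
    · rcases Set.pair_eq_pair_iff.1 heq with ⟨rfl, rfl⟩ | ⟨rfl, rfl⟩
      exacts [⟨z, hxz, hyz⟩, ⟨z, hyz, hxz⟩]
    · rcases h with h | h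
      exacts [absurd h hmp, absurd h hmq]
  rcases mem_segment_of_mem_convexHull_triple hne hhull hint with h | h | h
  · exact hside a b c hab hac hbc h
  · exact hside b c a hbc (G.symm _ _ hab) (G.symm _ _ hac) h
  · exact hside a c b hac hab (G.symm _ _ hbc) h

/-- If all inner faces are triangles, the ends of every edge of a cycle have a common
neighbour. -/
theorem exists_adj_adj_of_cycle (hE : G.IsEmbedded) (hF : G.InnerFacesTriangles) {h : ℕ}
    (h3 : 3 ≤ h) {u : ZMod h → ℝ × ℝ} (hu : Function.Injective u)
    (hadj : ∀ k, G.Adj (u k) (u (k + 1))) (j : ZMod h) :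
    ∃ r, G.Adj (u j) r ∧ G.Adj (u (j + 1)) r := by
  have : NeZero h := ⟨by omega⟩
  have htwo : (2 : ZMod h) ≠ 0 := fun h0 => by
    have := Nat.le_of_dvd two_pos ((ZMod.natCast_eq_zero_iff 2 h).1 (by exact_mod_cast h0))
    omega
  have hpq : u j ≠ u (j + 1) := fun h0 => G.loopless _ (h0 ▸ hadj j : G.Adj (u j) (u j))
  set p := u j
  set q := u (j + 1)
  set m := midpoint ℝ p q with hm
  have hmseg : m ∈ segment ℝ p q := midpoint_mem_segment p q
  have hmp : m ≠ p := by simpa [hm] using hpq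
  have hmq : m ≠ q := by simpa [hm] using hpq
  let φ : (ℝ × ℝ) ≃L[ℝ] ℂ := Complex.equivRealProdCLM.symm
  have hφseg : ∀ x a b, φ x ∈ segment ℝ (φ a) (φ b) ↔ x ∈ segment ℝ a b := by
    intro x a b
    have := image_segment ℝ (φ : (ℝ × ℝ) →ₗ[ℝ] ℂ).toAffineMap a b
    simp only [LinearMap.coe_toAffineMap] at this
    change φ '' segment ℝ a b = segment ℝ (φ a) (φ b) at this
    rw [← this, φ.injective.mem_set_image]
  have hφm : φ m = midpoint ℝ (φ p) (φ q) :=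
    (φ : (ℝ × ℝ) →ₗ[ℝ] ℂ).toAffineMap.map_midpoint p q
  let v : ZMod h → ℂ := fun k => φ (u k)
  let w : ℝ → ℝ × ℝ := fun s => φ.symm (φ m + s * (Complex.I * (φ q - φ p)))
  have hφw : ∀ s, φ (w s) = φ m + s * (Complex.I * (φ q - φ p)) := fun s =>
    φ.apply_symm_apply _
  have hw : Tendsto w (𝓝 0) (𝓝 m) := by
    have : Continuous w := φ.symm.continuous.comp (by fun_prop)
    simpa [w] using this.tendsto 0
  have hother : ∀ a b, G.Adj a b → m ∈ segment ℝ a b → ({p, q} : Set (ℝ × ℝ)) = {a, b} := by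
    intro a b hab hmab
    rcases hE.1 p q a b (hadj j) hab m hmseg hmab with heq | ⟨h, -⟩
    · exact heq
    · rcases h with h | h
      exacts [absurd h hmp, absurd h hmq]
  have hlocal : ∀ᶠ s in 𝓝 (0 : ℝ),
      ¬ ∃ a b, G.Adj a b ∧ ({p, q} : Set (ℝ × ℝ)) ≠ {a, b} ∧ w s ∈ segment ℝ a b :=
    hw.eventually ((isClosed_subdrawing (G := G)
      fun a b => ({p, q} : Set (ℝ × ℝ)) ≠ {a, b}).isOpen_compl.mem_nhds
        fun ⟨a, b, hab, hne, hmab⟩ => hne (hother a b hab hmab))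
  have hline : ∀ s : ℝ, s ≠ 0 → w s ∉ segment ℝ p q := by
    intro s hs hmem
    rw [← hφseg, hφw, hφm, segment_eq_image'] at hmem
    obtain ⟨t, -, ht⟩ := hmem
    have hd : φ q - φ p ≠ 0 := sub_ne_zero.2 (φ.injective.ne hpq.symm)
    have hcoef : (t : ℂ) = 1 / 2 + s * Complex.I := by
      apply mul_right_cancel₀ hd
      rw [midpoint_eq_smul_add] at ht
      simp only [Complex.real_smul, invOf_eq_inv] at ht
      push_cast at ht
      linear_combination ht
    have := congrArg Complex.im hcoef
    simp at this
    exact hs this.symm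
  have hoff : ∀ᶠ s in 𝓝 (0 : ℝ), s ≠ 0 → w s ∉ G.drawing := by
    filter_upwards [hlocal] with s hs hs0
    rintro ⟨a, b, hab, hmem⟩
    by_cases heq : ({p, q} : Set (ℝ × ℝ)) = {a, b}
    · refine hline s hs0 ?_
      rwa [← convexHull_pair, heq, convexHull_pair]
    · exact hs ⟨a, b, hab, heq, hmem⟩
  have hbounded : ∀ x, x ∉ G.drawing → Complex.polygonLogSum v (φ x) ≠ 0 →
      x ∈ G.boundedRegion := by
    refine fun x hx hne => ⟨hx, ?_⟩
    by_contra hunb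
    refine hne (Complex.polygonLogSum_eq_zero (C := φ '' connectedComponentIn G.drawingᶜ x)
      (isPreconnected_connectedComponentIn.image _ φ.continuous.continuousOn) (fun hb => hunb ?_)
      ?_ (Set.mem_image_of_mem _ (mem_connectedComponentIn hx)))
    · have := φ.symm.lipschitz.isBounded_image hb
      rwa [Set.image_image, Set.image_congr (fun y _ => φ.symm_apply_apply y), Set.image_id'] at this
    · rintro _ ⟨y, hy, rfl⟩ k hk
      exact connectedComponentIn_subset _ _ hy ⟨u k, u (k + 1), hadj k, (hφseg _ _ _).1 hk⟩
  have hjump := Complex.eventually_polygonLogSum_ne (v := v) (j := j) (φ.injective.ne hpq) <| by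
    intro k hk hmem
    change midpoint ℝ (φ p) (φ q) ∈ _ at hmem
    rw [← hφm, hφseg] at hmem
    rcases Set.pair_eq_pair_iff.1 (hother _ _ (hadj k) hmem) with ⟨h1, -⟩ | ⟨h1, h2⟩
    · exact hk (hu h1).symm
    · have h1 := hu h1
      have h2 := hu h2
      exact htwo (by linear_combination h2 - h1)
  change ∀ᶠ ε : ℝ in 𝓝[>] 0, Complex.polygonLogSum v (midpoint ℝ (φ p) (φ q) + ε *
    (Complex.I * (φ q - φ p))) ≠ Complex.polygonLogSum v (midpoint ℝ (φ p) (φ q) + (-ε : ℝ) *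
    (Complex.I * (φ q - φ p))) at hjump
  simp only [← hφm, ← hφw] at hjump
  have hneg : Tendsto (fun s : ℝ => -s) (𝓝 0) (𝓝 0) := by simpa using tendsto_neg (0 : ℝ)
  refine exists_adj_adj_of_mem_closure_boundedRegion hE hF (hadj j) hmseg hmp hmq ?_
  have hboth : ∀ᶠ ε : ℝ in 𝓝[>] 0, w ε ∈ G.boundedRegion ∨ w (-ε) ∈ G.boundedRegion := by
    filter_upwards [hjump, nhdsWithin_le_nhds hoff, nhdsWithin_le_nhds (hneg.eventually hoff),
      self_mem_nhdsWithin] with ε h1 h2 h3 h4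
    have hε : ε ≠ 0 := (Set.mem_Ioi.1 h4).ne'
    by_cases h0 : Complex.polygonLogSum v (φ (w ε)) = 0
    · exact Or.inr (hbounded _ (h3 (neg_ne_zero.2 hε)) fun h => h1 (h0.trans h.symm))
    · exact Or.inl (hbounded _ (h2 hε) h0)
  refine mem_closure_iff_nhds.2 fun U hU => ?_
  have hwU : ∀ᶠ ε in 𝓝 (0 : ℝ), w ε ∈ U ∧ w (-ε) ∈ U :=
    (hw.eventually_mem hU).and (hneg.eventually (hw.eventually_mem hU))
  obtain ⟨ε, h1 | h1, h2, h3⟩ := (hboth.and (hwU.filter_mono nhdsWithin_le_nhds)).exists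
  exacts [⟨_, h2, h1⟩, ⟨_, h3, h1⟩]

end PlaneGraph

/-- Let `T` be a maximal outerplanar graph of order 5 with boundary cycle
`C = (u_1, …, u_5, u_1)`.  Then for every vertex `u_i` of `T`, there exists a total
dominating set of `T` of size 2 that contains `u_i`. -/
theorem MOP_order_five_TDS_of_size_two (T : PlaneGraph) (u : ZMod 5 → ℝ × ℝ)
    (hT : T.IsNearTriangulation) (hu : T.IsBoundaryCycle u)
    (hmop : ∀ v ∈ T.verts, v ∈ Set.range u) (hcard : T.verts.card = 5) (i : ZMod 5) :
    ∃ D : Finset (ℝ × ℝ), T.IsTDS D ∧ D.card = 2 ∧ u i ∈ D := by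
  obtain ⟨h3, hinj, hmem, hadj, -, -⟩ := hu
  have hcases : ∀ i k : ZMod 5, k = i ∨ k = i + 1 ∨ k = i + 2 ∨ k = i + 3 ∨ k = i + 4 := by
    decide
  have hfive : ∀ i : ZMod 5, i = i + 4 + 1 := by decide
  have hone : ∀ i : ZMod 5, i + 1 ≠ i := by decide
  have hfour : ∀ i : ZMod 5, i + 4 ≠ i := by decide
  have hadj' : ∀ a b, b = a + 1 → T.Adj (u a) (u b) ∧ T.Adj (u b) (u a) := by
    rintro a _ rfl
    exact ⟨hadj a, T.symm _ _ (hadj a)⟩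
  have e01 := hadj' i (i + 1) rfl
  have e12 := hadj' (i + 1) (i + 2) (by ring)
  have e23 := hadj' (i + 2) (i + 3) (by ring)
  have e34 := hadj' (i + 3) (i + 4) (by ring)
  have e40 := hadj' (i + 4) i (hfive i)
  obtain ⟨r, hr2, hr3⟩ := PlaneGraph.exists_adj_adj_of_cycle hT.1 hT.2.2 h3 hinj hadj (i + 2)
  rw [show i + 2 + 1 = i + 3 by ring] at hr3
  obtain ⟨k, rfl⟩ := hmop r (T.mem_of_adj _ _ hr2).2
  have build : ∀ l, l ≠ i → (∀ n, T.Adj (u n) (u i) ∨ T.Adj (u n) (u l)) →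
      ∃ D : Finset (ℝ × ℝ), T.IsTDS D ∧ D.card = 2 ∧ u i ∈ D := by
    intro l hl hdom
    refine ⟨{u i, u l}, ⟨?_, ?_⟩, Finset.card_pair (hinj.ne hl.symm), by simp⟩
    · simp [Finset.insert_subset_iff, hmem]
    · intro x hx
      obtain ⟨n, rfl⟩ := hmop x hx
      simpa using hdom n
  rcases hcases i k with h | h | h | h | h <;> rw [h] at hr2 hr3
  · refine build (i + 4) (hfour i) fun n => ?_
    rcases hcases i n with rfl | rfl | rfl | rfl | rfl <;> tauto
  · refine build (i + 1) (hone i) fun n => ?_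
    rcases hcases i n with rfl | rfl | rfl | rfl | rfl <;> tauto
  · exact absurd hr2 (T.loopless _)
  · exact absurd hr3 (T.loopless _)
  · refine build (i + 4) (hfour i) fun n => ?_
    rcases hcases i n with rfl | rfl | rfl | rfl | rfl <;> tauto
end
end

section
/- Let T be a maximal outerplanar graph of order 6 with boundary cycle C = (u_1, ..., u_6, u_1). Then for every pair u_i, u_{i+1} of consecutive vertices of C, there exists a total dominating set of T of size 2 that contains u_i or u_{i+1}. -/
/-!
Common definitions.

A *plane graph* is a finite graph whose vertices are points of the plane `ℝ × ℝ` and whose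
edges are drawn as straight-line segments between their endpoints (by Fáry's theorem every
planar graph admits such a drawing).  A *near-triangulation* is a plane graph that is properly
embedded, biconnected, and all of whose bounded faces are triangles (the faces are the
connected components of the complement of the drawing).  The boundary cycle lists, cyclically,
the vertices on the outer (unbounded) face.
-/

open scoped Classical

noncomputable section

namespace PlaneGraph

open Filter Topology Bornology

/-- The signed angle, in `(-π, π]`, under which the segment from `a` to `b` is seen from `x`. -/
def subtendedAngle (a b x : ℝ × ℝ) : ℝ :=
  Complex.arg ((Complex.equivRealProdCLM.symm (b - x)) / (Complex.equivRealProdCLM.symm (a - x)))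

/-- The total angle swept by a closed polygon as seen from `x`, i.e. `2π` times the winding
number. -/
def totalAngle {h : ℕ} [NeZero h] (u : ZMod h → ℝ × ℝ) (x : ℝ × ℝ) : ℝ :=
  ∑ i, subtendedAngle (u i) (u (i + 1)) x

theorem continuousAt_subtendedAngle {a b x : ℝ × ℝ} (hx : x ∉ segment ℝ a b) :
    ContinuousAt (subtendedAngle a b) x := by
  have ha : Complex.equivRealProdCLM.symm (a - x) ≠ 0 := by
    intro h
    rw [map_eq_zero_iff _ Complex.equivRealProdCLM.symm.injective, sub_eq_zero] at h
    exact hx (h ▸ left_mem_segment ℝ a b)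
  unfold subtendedAngle
  have hc : ContinuousAt (fun x : ℝ × ℝ => (Complex.equivRealProdCLM.symm (b - x)) /
      (Complex.equivRealProdCLM.symm (a - x))) x :=
    ContinuousAt.div (by fun_prop) (by fun_prop) ha
  refine ContinuousAt.comp (f := fun x : ℝ × ℝ => (Complex.equivRealProdCLM.symm (b - x)) /
      (Complex.equivRealProdCLM.symm (a - x))) (Complex.continuousAt_arg ?_) hc
  by_contra hs
  rw [Complex.mem_slitPlane_iff_not_le_zero, not_not, Complex.nonpos_iff] at hs
  obtain ⟨hre, him⟩ := hs
  set w := (Complex.equivRealProdCLM.symm (b - x)) / (Complex.equivRealProdCLM.symm (a - x)) with hw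
  have hw2 : w = ((w.re : ℝ) : ℂ) := Complex.ext rfl (by simpa using him)
  have h1 : Complex.equivRealProdCLM.symm (b - x)
      = w.re • Complex.equivRealProdCLM.symm (a - x) := by
    rw [Complex.real_smul, ← hw2, hw, div_mul_cancel₀ _ ha]
  rw [← map_smul] at h1
  have h2 := Complex.equivRealProdCLM.symm.injective h1
  apply hx
  set r := w.re
  have hr : (0 : ℝ) < 1 - r := by linarith
  refine ⟨-r / (1 - r), 1 / (1 - r), by apply div_nonneg <;> linarith, by positivity,
    by field_simp; ring, ?_⟩
  have h3 : (1 - r) • x = b - r • a := by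
    rw [sub_smul, one_smul]
    rw [smul_sub] at h2
    linear_combination (exp := 1) -h2
  have h4 : x = (1 - r)⁻¹ • (b - r • a) := by
    rw [← h3, smul_smul, inv_mul_cancel₀ hr.ne', one_smul]
  rw [h4, smul_sub, smul_smul, neg_div, neg_smul, div_eq_inv_mul, one_div]
  abel

theorem tendsto_subtendedAngle_cobounded (a b : ℝ × ℝ) :
    Tendsto (subtendedAngle a b) (cobounded (ℝ × ℝ)) (𝓝 0) := by
  have hinj := Complex.equivRealProdCLM.symm.injective
  have h1 : Tendsto (fun x : ℝ × ℝ => Complex.equivRealProdCLM.symm (a - x))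
      (cobounded _) (cobounded ℂ) :=
    (Complex.equivRealProdCLM.symm.antilipschitz.tendsto_cobounded).comp
      (tendsto_const_sub_cobounded a)
  have h2 := (tendsto_inv₀_cobounded.comp h1).const_mul (Complex.equivRealProdCLM.symm (b - a))
  have h3 := h2.const_add 1
  rw [mul_zero, add_zero] at h3
  have h4 : Tendsto (fun x : ℝ × ℝ => (Complex.equivRealProdCLM.symm (b - x)) /
      (Complex.equivRealProdCLM.symm (a - x))) (cobounded _) (𝓝 1) := by
    refine h3.congr' ?_
    filter_upwards [isBounded_def.1 (isBounded_singleton (x := a))] with x hx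
    have ha : Complex.equivRealProdCLM.symm (a - x) ≠ 0 := by
      rw [Ne, map_eq_zero_iff _ hinj, sub_eq_zero]
      exact fun h => hx h.symm
    have : b - x = (a - x) + (b - a) := by abel
    rw [this, map_add, add_div, div_self ha]
    rfl
  have h5 := (Complex.continuousAt_arg (x := 1) (by simp)).tendsto.comp h4
  rw [Complex.arg_one] at h5
  exact h5

theorem tendsto_totalAngle_cobounded {h : ℕ} [NeZero h] (u : ZMod h → ℝ × ℝ) :
    Tendsto (totalAngle u) (cobounded (ℝ × ℝ)) (𝓝 0) := by
  have := tendsto_finsetSum (Finset.univ : Finset (ZMod h))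
    (fun i _ => tendsto_subtendedAngle_cobounded (u i) (u (i + 1)))
  rwa [Finset.sum_const_zero] at this

theorem exists_totalAngle_eq {h : ℕ} [NeZero h] (u : ZMod h → ℝ × ℝ) {x : ℝ × ℝ}
    (hx : ∀ i, x ≠ u i) : ∃ k : ℤ, totalAngle u x = 2 * Real.pi * k := by
  have hne : ∀ i, Complex.equivRealProdCLM.symm (u i - x) ≠ 0 := fun i => by
    rw [Ne, map_eq_zero_iff _ Complex.equivRealProdCLM.symm.injective, sub_eq_zero]
    exact (hx i).symm
  have h0 : ((totalAngle u x : ℝ) : Real.Angle) = 0 := by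
    have : ((totalAngle u x : ℝ) : Real.Angle)
        = ∑ i, ((subtendedAngle (u i) (u (i + 1)) x : ℝ) : Real.Angle) :=
      map_sum Real.Angle.coeHom _ _
    rw [this]
    simp only [subtendedAngle, Complex.arg_div_coe_angle (hne _) (hne _)]
    rw [Finset.sum_sub_distrib, sub_eq_zero]
    exact Equiv.sum_comp (Equiv.addRight (1 : ZMod h))
      (fun i => (Complex.arg (Complex.equivRealProdCLM.symm (u i - x)) : Real.Angle))
  rw [← Real.Angle.coe_zero, Real.Angle.angle_eq_iff_two_pi_dvd_sub] at h0
  simpa using h0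

/-- The total angle vanishes on every unbounded connected set avoiding the polygon. -/
theorem totalAngle_eq_zero_of_not_isBounded {h : ℕ} [NeZero h] (u : ZMod h → ℝ × ℝ)
    {C : Set (ℝ × ℝ)} (hC : IsPreconnected C) (hub : ¬ IsBounded C)
    (hd : ∀ x ∈ C, ∀ i, x ∉ segment ℝ (u i) (u (i + 1))) {x : ℝ × ℝ} (hx : x ∈ C) :
    totalAngle u x = 0 := by
  have hval : ∀ y ∈ C, ∃ k : ℤ, totalAngle u y = 2 * Real.pi * k := fun y hy =>
    exists_totalAngle_eq u fun i hi => hd y hy i (hi ▸ left_mem_segment ℝ _ _)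
  have hcont : ContinuousOn (fun y => |totalAngle u y|) C := by
    refine ContinuousOn.abs fun y hy => ContinuousAt.continuousWithinAt ?_
    exact tendsto_finsetSum _ fun i _ => continuousAt_subtendedAngle (hd y hy i)
  obtain ⟨y, hyC, hy⟩ : ∃ y ∈ C, |totalAngle u y| < Real.pi := by
    by_contra hcon
    push Not at hcon
    have hev := (tendsto_totalAngle_cobounded u).abs.eventually_lt_const
      (u := Real.pi) (by simpa using Real.pi_pos)
    refine hub (isBounded_def.2 ?_)
    filter_upwards [hev] with y hy hyC using absurd (hcon y hyC) (not_le.2 hy)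
  have key : ∀ k : ℤ, |2 * Real.pi * k| ≠ Real.pi := by
    intro k hk
    rw [abs_mul, abs_of_pos Real.two_pi_pos] at hk
    have h1 : (2 : ℝ) * |(k : ℝ)| = 1 := by
      have := Real.pi_pos
      apply mul_left_cancel₀ this.ne'
      linarith
    have h2 : (2 : ℤ) * |k| = 1 := by exact_mod_cast h1
    omega
  by_contra hne
  have hxpi : Real.pi ≤ |totalAngle u x| := by
    obtain ⟨k, hk⟩ := hval x hx
    have hk0 : k ≠ 0 := by rintro rfl; simp at hk; exact hne hk
    rw [hk, abs_mul, abs_of_pos Real.two_pi_pos]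
    have : (1 : ℝ) ≤ |(k : ℝ)| := by exact_mod_cast Int.one_le_abs hk0
    nlinarith [Real.pi_pos]
  obtain ⟨z, hzC, hz⟩ := hC.intermediate_value hyC hx hcont ⟨hy.le, hxpi⟩
  obtain ⟨k, hk⟩ := hval z hzC
  exact key k (by rw [← hk]; exact hz)

/-- The displacement `b - a` rotated by a right angle. -/
def normal (a b : ℝ × ℝ) : ℝ × ℝ := (-(b.2 - a.2), b.1 - a.1)

theorem subtendedAngle_midpoint_add {a b : ℝ × ℝ} (hab : a ≠ b) (t : ℝ) :
    subtendedAngle a b (midpoint ℝ a b + t • normal a b)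
      = Complex.arg ((1 / 2 - t * Complex.I) / (-1 / 2 - t * Complex.I)) := by
  have hne : Complex.equivRealProdCLM.symm (b - a) ≠ 0 := by
    rw [Ne, map_eq_zero_iff _ Complex.equivRealProdCLM.symm.injective, sub_eq_zero]
    exact hab.symm
  have h1 : Complex.equivRealProdCLM.symm (b - (midpoint ℝ a b + t • normal a b))
      = Complex.equivRealProdCLM.symm (b - a) * (1 / 2 - t * Complex.I) := by
    apply Complex.ext <;> simp [midpoint_eq_smul_add, normal] <;> ring
  have h2 : Complex.equivRealProdCLM.symm (a - (midpoint ℝ a b + t • normal a b))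
      = Complex.equivRealProdCLM.symm (b - a) * (-1 / 2 - t * Complex.I) := by
    apply Complex.ext <;> simp [midpoint_eq_smul_add, normal] <;> ring
  rw [subtendedAngle, h1, h2, mul_div_mul_left _ _ hne]

theorem tendsto_subtendedAngle_sub {a b : ℝ × ℝ} (hab : a ≠ b) :
    Tendsto (fun t : ℝ => subtendedAngle a b (midpoint ℝ a b + t • normal a b)
      - subtendedAngle a b (midpoint ℝ a b + (-t) • normal a b)) (𝓝[>] 0)
      (𝓝 (2 * Real.pi)) := by
  simp only [subtendedAngle_midpoint_add hab]
  set f : ℝ → ℂ := fun t => (1 / 2 - t * Complex.I) / (-1 / 2 - t * Complex.I) with hf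
  have hden : ∀ t : ℝ, (-1 / 2 - t * Complex.I : ℂ) ≠ 0 := fun t h => by
    have := congrArg Complex.re h
    norm_num at this
  have hfc : Continuous f := Continuous.div (by fun_prop) (by fun_prop) hden
  have hf0 : f 0 = -1 := by simp only [hf]; norm_num
  have him : ∀ t : ℝ, (f t).im = t / (1 / 4 + t ^ 2) := fun t => by
    simp [hf, Complex.div_im, Complex.normSq_apply]
    field_simp
    ring
  have hpos : Tendsto (fun t : ℝ => f t) (𝓝[>] 0) (𝓝[{z : ℂ | 0 ≤ z.im}] (-1)) := by
    refine tendsto_nhdsWithin_iff.2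
      ⟨hf0 ▸ (hfc.tendsto 0).mono_left nhdsWithin_le_nhds, ?_⟩
    filter_upwards [self_mem_nhdsWithin] with t (ht : 0 < t)
    rw [him]
    positivity
  have hneg : Tendsto (fun t : ℝ => f (-t)) (𝓝[>] 0) (𝓝[{z : ℂ | z.im < 0}] (-1)) := by
    refine tendsto_nhdsWithin_iff.2 ⟨?_, ?_⟩
    · have : Tendsto (fun t : ℝ => f (-t)) (𝓝 0) (𝓝 (f (-0))) :=
        (hfc.comp continuous_neg).tendsto 0
      rw [neg_zero, hf0] at this
      exact this.mono_left nhdsWithin_le_nhds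
    · filter_upwards [self_mem_nhdsWithin] with t (ht : 0 < t)
      rw [him]
      have : 0 < t / (1 / 4 + (-t) ^ 2) := by positivity
      rw [neg_div]
      linarith
  have h1 := (Complex.tendsto_arg_nhdsWithin_im_nonneg_of_re_neg_of_im_zero
    (z := -1) (by simp) (by simp)).comp hpos
  have h2 := (Complex.tendsto_arg_nhdsWithin_im_neg_of_re_neg_of_im_zero
    (z := -1) (by simp) (by simp)).comp hneg
  have h3 := h1.sub h2
  rw [sub_neg_eq_add, ← two_mul] at h3
  exact h3

/-- The total angle jumps when crossing a side of the polygon at its midpoint. -/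
theorem frequently_totalAngle_ne_zero {h : ℕ} [NeZero h] {u : ZMod h → ℝ × ℝ} {i : ZMod h}
    (hne : u i ≠ u (i + 1))
    (hoff : ∀ j, j ≠ i → midpoint ℝ (u i) (u (i + 1)) ∉ segment ℝ (u j) (u (j + 1))) :
    ∃ᶠ t in 𝓝[≠] (0 : ℝ),
      totalAngle u (midpoint ℝ (u i) (u (i + 1)) + t • normal (u i) (u (i + 1))) ≠ 0 := by
  set m := midpoint ℝ (u i) (u (i + 1)) with hm
  set n := normal (u i) (u (i + 1)) with hn
  intro hcon
  simp only [not_not] at hcon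
  have hp : ∀ᶠ t in 𝓝[>] (0 : ℝ), totalAngle u (m + t • n) = 0 :=
    hcon.filter_mono (nhdsWithin_mono _ fun t (ht : 0 < t) => ht.ne')
  have hq : ∀ᶠ t in 𝓝[>] (0 : ℝ), totalAngle u (m + (-t) • n) = 0 := by
    have : Tendsto (fun t : ℝ => -t) (𝓝[>] 0) (𝓝[≠] 0) := by
      refine tendsto_nhdsWithin_iff.2 ⟨?_, ?_⟩
      · have : Tendsto (fun t : ℝ => -t) (𝓝 0) (𝓝 (-0)) := continuous_neg.tendsto 0
        rw [neg_zero] at this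
        exact this.mono_left nhdsWithin_le_nhds
      · filter_upwards [self_mem_nhdsWithin] with t (ht : 0 < t)
        simpa using ht.ne'
    exact this.eventually hcon
  have hlim : Tendsto (fun t : ℝ => totalAngle u (m + t • n) - totalAngle u (m + (-t) • n))
      (𝓝[>] 0) (𝓝 (∑ j, if j = i then 2 * Real.pi else 0)) := by
    simp only [totalAngle, ← Finset.sum_sub_distrib]
    refine tendsto_finsetSum _ fun j _ => ?_
    split_ifs with hj
    · subst hj
      exact tendsto_subtendedAngle_sub hne
    · have hc := continuousAt_subtendedAngle (hoff j hj)
      have hl : ∀ g : ℝ → ℝ, Continuous g → g 0 = 0 →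
          Tendsto (fun t => subtendedAngle (u j) (u (j + 1)) (m + g t • n)) (𝓝[>] 0)
            (𝓝 (subtendedAngle (u j) (u (j + 1)) m)) := fun g hg hg0 => by
        refine hc.tendsto.comp (Tendsto.mono_left ?_ nhdsWithin_le_nhds)
        have : Continuous fun t => m + g t • n := by fun_prop
        simpa [hg0] using this.tendsto 0
      simpa using (hl id continuous_id rfl).sub (hl _ continuous_neg neg_zero)
  rw [Finset.sum_ite_eq' Finset.univ i, if_pos (Finset.mem_univ i)] at hlim
  have hzero : Tendsto (fun t : ℝ => totalAngle u (m + t • n) - totalAngle u (m + (-t) • n))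
      (𝓝[>] 0) (𝓝 0) := by
    refine tendsto_const_nhds.congr' ?_
    filter_upwards [hp, hq] with t h1 h2
    rw [h1, h2, sub_zero]
  exact Real.two_pi_pos.ne' (tendsto_nhds_unique hlim hzero)

/-- The orientation form: its sign tells on which side of the line `ab` the point `x` lies. -/
def side (a b x : ℝ × ℝ) : ℝ :=
  (b.1 - a.1) * (x.2 - a.2) - (b.2 - a.2) * (x.1 - a.1)

theorem side_eq_zero_of_mem_segment {a b x : ℝ × ℝ} (hx : x ∈ segment ℝ a b) :
    side a b x = 0 := by
  obtain ⟨s, t, -, -, hst, rfl⟩ := hx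
  obtain rfl : s = 1 - t := by linarith
  simp [side]
  ring

theorem side_midpoint_add_smul_normal (a b : ℝ × ℝ) (t : ℝ) :
    side a b (midpoint ℝ a b + t • normal a b)
      = t * ((b.1 - a.1) ^ 2 + (b.2 - a.2) ^ 2) := by
  simp [side, normal, midpoint_eq_smul_add]
  ring

theorem sum_sq_sub_pos {a b : ℝ × ℝ} (hab : a ≠ b) :
    0 < (b.1 - a.1) ^ 2 + (b.2 - a.2) ^ 2 := by
  by_contra hcon
  apply hab
  apply Prod.ext <;> nlinarith [sq_nonneg (b.1 - a.1), sq_nonneg (b.2 - a.2)]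

theorem eventually_mem_segment_of_side_eq_zero {a b : ℝ × ℝ} (hab : a ≠ b) :
    ∀ᶠ x in 𝓝 (midpoint ℝ a b), side a b x = 0 → x ∈ segment ℝ a b := by
  have hd := sum_sq_sub_pos hab
  set d := (b.1 - a.1) ^ 2 + (b.2 - a.2) ^ 2 with hdd
  set c : ℝ × ℝ → ℝ := fun x => ((b.1 - a.1) * (x.1 - a.1) + (b.2 - a.2) * (x.2 - a.2)) / d
    with hc
  have hcc : Continuous c := by fun_prop
  have hm : c (midpoint ℝ a b) = 1 / 2 := by
    simp only [hc, midpoint_eq_smul_add]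
    rw [div_eq_iff hd.ne']
    simp [hdd]
    ring
  have h0 := hcc.continuousAt.eventually_const_lt (show 0 < c (midpoint ℝ a b) by rw [hm]; norm_num)
  have h1 := hcc.continuousAt.eventually_lt_const (show c (midpoint ℝ a b) < 1 by rw [hm]; norm_num)
  filter_upwards [h0, h1] with x hx0 hx1 hs
  refine ⟨1 - c x, c x, by linarith, hx0.le, by ring, ?_⟩
  unfold side at hs
  have hcx : c x * d = (b.1 - a.1) * (x.1 - a.1) + (b.2 - a.2) * (x.2 - a.2) :=
    div_mul_cancel₀ _ hd.ne'
  apply Prod.ext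
  · apply mul_left_cancel₀ hd.ne'
    simp only [Prod.fst_add, Prod.smul_fst, smul_eq_mul]
    linear_combination (b.1 - a.1) * hcx + (b.2 - a.2) * hs - (x.1 - a.1) * hdd
  · apply mul_left_cancel₀ hd.ne'
    simp only [Prod.snd_add, Prod.smul_snd, smul_eq_mul]
    linear_combination (b.2 - a.2) * hcx - (b.1 - a.1) * hs - (x.2 - a.2) * hdd

theorem isClosed_real_segment (a b : ℝ × ℝ) : IsClosed (segment ℝ a b) := by
  rw [← convexHull_pair]
  exact (Set.toFinite _).isClosed_convexHull ℝ

variable {G : PlaneGraph}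

theorem Adj.ne {a b : ℝ × ℝ} (h : G.Adj a b) : a ≠ b := fun hab =>
  G.loopless a (hab ▸ h)

theorem midpoint_mem_drawing {a b : ℝ × ℝ} (h : G.Adj a b) : midpoint ℝ a b ∈ G.drawing :=
  ⟨a, b, h, midpoint_mem_segment a b⟩

theorem IsEmbedded.pair_eq_of_midpoint_mem (hE : G.IsEmbedded) {a b c d : ℝ × ℝ}
    (hab : G.Adj a b) (hcd : G.Adj c d) (hm : midpoint ℝ a b ∈ segment ℝ c d) :
    ({a, b} : Set (ℝ × ℝ)) = {c, d} := by
  rcases hE.1 a b c d hab hcd _ (midpoint_mem_segment a b) hm with h | ⟨h, -⟩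
  · exact h
  · have hne := Adj.ne hab
    simp [midpoint_eq_left_iff, midpoint_eq_right_iff, hne] at h

/-- Near the midpoint of an edge, the drawing is the line carrying that edge. -/
theorem IsEmbedded.eventually_mem_drawing_iff (hE : G.IsEmbedded) {a b : ℝ × ℝ}
    (hab : G.Adj a b) :
    ∀ᶠ x in 𝓝 (midpoint ℝ a b), x ∈ G.drawing ↔ side a b x = 0 := by
  have hfin : ∀ᶠ x in 𝓝 (midpoint ℝ a b), ∀ e ∈ G.verts ×ˢ G.verts,
      G.Adj e.1 e.2 → x ∈ segment ℝ e.1 e.2 → x ∈ segment ℝ a b := by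
    refine (eventually_all_finset _).2 fun e _ => ?_
    by_cases he : G.Adj e.1 e.2
    · by_cases hm : midpoint ℝ a b ∈ segment ℝ e.1 e.2
      · have := hE.pair_eq_of_midpoint_mem hab he hm
        rw [← convexHull_pair, ← convexHull_pair, this]
        exact Eventually.of_forall fun _ _ h => h
      · filter_upwards [(isClosed_real_segment e.1 e.2).isOpen_compl.mem_nhds hm] with x hx _ hx'
        exact absurd hx' hx
    · exact Eventually.of_forall fun _ h => absurd h he
  filter_upwards [hfin, eventually_mem_segment_of_side_eq_zero (Adj.ne hab)] with x h1 h2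
  constructor
  · rintro ⟨c, d, hcd, hx⟩
    have hv := G.mem_of_adj c d hcd
    exact side_eq_zero_of_mem_segment (h1 (c, d) (Finset.mem_product.2 hv) hcd hx)
  · exact fun h => ⟨a, b, hab, h2 h⟩

/-- Near the midpoint of an edge, points on the same side of it lie in the same face. -/
theorem IsEmbedded.exists_nhds_face_eq (hE : G.IsEmbedded) {a b : ℝ × ℝ} (hab : G.Adj a b) :
    ∃ U ∈ 𝓝 (midpoint ℝ a b), (∀ x ∈ U, x ∈ G.drawing ↔ side a b x = 0) ∧
      ∀ x ∈ U, ∀ y ∈ U, 0 < side a b x * side a b y →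
        connectedComponentIn G.drawingᶜ x = connectedComponentIn G.drawingᶜ y := by
  obtain ⟨ε, hε, hball⟩ := Metric.eventually_nhds_iff_ball.1 (hE.eventually_mem_drawing_iff hab)
  refine ⟨Metric.ball (midpoint ℝ a b) ε, Metric.ball_mem_nhds _ hε, hball, ?_⟩
  intro x hx y hy hxy
  have hseg : segment ℝ x y ⊆ G.drawingᶜ := by
    intro z hz hzd
    have hz0 := (hball z ((convex_ball _ _).segment_subset hx hy hz)).1 hzd
    obtain ⟨s, t, hs, ht, hst, rfl⟩ := hz
    have hlin : side a b (s • x + t • y) = s * side a b x + t * side a b y := by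
      obtain rfl : s = 1 - t := by linarith
      simp [side]
      ring
    rw [hlin] at hz0
    rcases pos_and_pos_or_neg_and_neg_of_mul_pos hxy with ⟨h1, h2⟩ | ⟨h1, h2⟩
    · rcases hs.eq_or_lt with rfl | hs'
      · obtain rfl : t = 1 := by linarith
        linarith
      · nlinarith [mul_pos hs' h1, mul_nonneg ht h2.le]
    · rcases hs.eq_or_lt with rfl | hs'
      · obtain rfl : t = 1 := by linarith
        linarith
      · nlinarith [mul_neg_of_pos_of_neg hs' h1, mul_nonpos_of_nonneg_of_nonpos ht h2.le]
  exact connectedComponentIn_eq ((convex_segment x y).isPreconnected.subset_connectedComponentIn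
    (left_mem_segment ℝ x y) hseg (right_mem_segment ℝ x y))

theorem IsFace.eq_connectedComponentIn {F : Set (ℝ × ℝ)} (hF : G.IsFace F) {x : ℝ × ℝ}
    (hx : x ∈ F) : x ∉ G.drawing ∧ connectedComponentIn G.drawingᶜ x = F := by
  obtain ⟨y, -, rfl⟩ := hF
  exact ⟨connectedComponentIn_subset _ _ hx, (connectedComponentIn_eq hx).symm⟩

/-- A side of a polygon made of edges of the graph borders some bounded face. -/
theorem IsEmbedded.frequently_isBounded (hE : G.IsEmbedded) {h : ℕ} [NeZero h]
    {u : ZMod h → ℝ × ℝ} (hadj : ∀ i, G.Adj (u i) (u (i + 1))) {i : ZMod h}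
    (hsimple : ∀ j, j ≠ i → ({u i, u (i + 1)} : Set (ℝ × ℝ)) ≠ {u j, u (j + 1)}) :
    ∃ᶠ x in 𝓝 (midpoint ℝ (u i) (u (i + 1))),
      x ∉ G.drawing ∧ IsBounded (connectedComponentIn G.drawingᶜ x) := by
  set m := midpoint ℝ (u i) (u (i + 1)) with hm
  have hne := Adj.ne (hadj i)
  have hlim : Tendsto (fun t : ℝ => m + t • normal (u i) (u (i + 1))) (𝓝[≠] 0) (𝓝 m) := by
    have : Continuous fun t : ℝ => m + t • normal (u i) (u (i + 1)) := by fun_prop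
    have h0 := this.tendsto 0
    rw [zero_smul, add_zero] at h0
    exact h0.mono_left nhdsWithin_le_nhds
  have hfreq := frequently_totalAngle_ne_zero hne fun j hj hmem =>
    hsimple j hj (hE.pair_eq_of_midpoint_mem (hadj i) (hadj j) hmem)
  refine hlim.frequently ((hfreq.and_eventually ((hlim.eventually
    (hE.eventually_mem_drawing_iff (hadj i))).and self_mem_nhdsWithin)).mono ?_)
  rintro t ⟨ht, hiff, ht0⟩
  have hx : m + t • normal (u i) (u (i + 1)) ∉ G.drawing := by
    rw [hiff, side_midpoint_add_smul_normal]
    exact mul_ne_zero ht0 (sum_sq_sub_pos hne).ne'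
  refine ⟨hx, ?_⟩
  by_contra hub
  exact ht (totalAngle_eq_zero_of_not_isBounded u isPreconnected_connectedComponentIn hub
    (fun y hy j hyj => connectedComponentIn_subset _ _ hy ⟨_, _, hadj j, hyj⟩)
    (mem_connectedComponentIn hx))

/-- A side of a simple polygon made of edges on the outer face borders exactly one bounded
face. -/
theorem IsEmbedded.existsUnique_face (hE : G.IsEmbedded) {h : ℕ} [NeZero h]
    {u : ZMod h → ℝ × ℝ} (hadj : ∀ i, G.Adj (u i) (u (i + 1))) {i : ZMod h}
    (hsimple : ∀ j, j ≠ i → ({u i, u (i + 1)} : Set (ℝ × ℝ)) ≠ {u j, u (j + 1)})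
    (hout : segment ℝ (u i) (u (i + 1)) ⊆ frontier G.outerRegion) :
    ∃! F, G.IsFace F ∧ IsBounded F ∧ midpoint ℝ (u i) (u (i + 1)) ∈ closure F := by
  obtain ⟨U, hU, hdraw, hface⟩ := hE.exists_nhds_face_eq (hadj i)
  have hfreq := hE.frequently_isBounded hadj hsimple
  obtain ⟨y, ⟨hyd, hyub⟩, hyU⟩ := ((mem_closure_iff_frequently.1
    (frontier_subset_closure (hout (midpoint_mem_segment _ _)))).and_eventually hU).exists
  obtain ⟨x, ⟨hxd, hxb⟩, hxU⟩ := (hfreq.and_eventually hU).exists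
  have opp : ∀ z ∈ U, z ∉ G.drawing → IsBounded (connectedComponentIn G.drawingᶜ z) →
      side (u i) (u (i + 1)) z * side (u i) (u (i + 1)) y < 0 := by
    intro z hzU hzd hzb
    rcases lt_trichotomy (side (u i) (u (i + 1)) z * side (u i) (u (i + 1)) y) 0 with h | h | h
    · exact h
    · rcases mul_eq_zero.1 h with h | h
      · exact absurd ((hdraw z hzU).2 h) hzd
      · exact absurd ((hdraw y hyU).2 h) hyd
    · exact absurd (hface z hzU y hyU h ▸ hzb) hyub
  have same : ∀ z ∈ U, z ∉ G.drawing → IsBounded (connectedComponentIn G.drawingᶜ z) →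
      connectedComponentIn G.drawingᶜ z = connectedComponentIn G.drawingᶜ x := by
    intro z hzU hzd hzb
    refine hface z hzU x hxU ?_
    have h1 := opp z hzU hzd hzb
    have h2 := opp x hxU hxd hxb
    by_contra hcon
    nlinarith [mul_pos_of_neg_of_neg h1 h2, sq_nonneg (side (u i) (u (i + 1)) y)]
  refine ⟨connectedComponentIn G.drawingᶜ x, ⟨⟨x, hxd, rfl⟩, hxb, ?_⟩, ?_⟩
  · refine mem_closure_iff_frequently.2 ((hfreq.and_eventually hU).mono ?_)
    rintro z ⟨⟨hzd, hzb⟩, hzU⟩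
    exact same z hzU hzd hzb ▸ mem_connectedComponentIn hzd
  · rintro F ⟨hF, hFb, hFm⟩
    obtain ⟨z, hzF, hzU⟩ := ((mem_closure_iff_frequently.1 hFm).and_eventually hU).exists
    obtain ⟨hzd, hz⟩ := hF.eq_connectedComponentIn hzF
    rw [← hz]
    exact same z hzU hzd (hz.symm ▸ hFb)

theorem mem_convexHull_triple {a b c x : ℝ × ℝ} :
    x ∈ convexHull ℝ ({a, b, c} : Set (ℝ × ℝ)) ↔
      ∃ r s t : ℝ, 0 ≤ r ∧ 0 ≤ s ∧ 0 ≤ t ∧ r + s + t = 1 ∧ r • a + s • b + t • c = x := by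
  constructor
  · rw [convexHull_insert (Set.insert_nonempty b {c}), convexHull_pair,
      convexJoin_singleton_left]
    intro hx
    obtain ⟨y, ⟨s, t, hs, ht, hst, rfl⟩, p, q, hp, hq, hpq, rfl⟩ := Set.mem_iUnion₂.1 hx
    refine ⟨p, q * s, q * t, hp, mul_nonneg hq hs, mul_nonneg hq ht, ?_, ?_⟩
    · rw [add_assoc, ← mul_add, hst, mul_one, hpq]
    · rw [smul_add, smul_smul, smul_smul, add_assoc]
  · rintro ⟨r, s, t, hr, hs, ht, hsum, rfl⟩
    have := (convex_convexHull ℝ ({a, b, c} : Set (ℝ × ℝ))).sum_mem (t := Finset.univ)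
      (w := ![r, s, t]) (z := ![a, b, c])
      (by intro i _; fin_cases i <;> assumption)
      (by simpa [Fin.sum_univ_three] using hsum)
      (by intro i _; fin_cases i <;> exact subset_convexHull ℝ _ (by simp))
    simpa [Fin.sum_univ_three] using this

theorem closure_openTriangle {a b c : ℝ × ℝ} (hne : (openTriangle a b c).Nonempty) :
    closure (openTriangle a b c) = convexHull ℝ {a, b, c} := by
  unfold openTriangle at hne ⊢
  rw [(convex_convexHull ℝ _).closure_interior_eq_closure_of_nonempty_interior hne]
  exact ((Set.toFinite _).isClosed_convexHull ℝ).closure_eq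

/-- The boundary of a triangle consists of its three sides. -/
theorem mem_side_of_mem_closure_openTriangle {a b c x : ℝ × ℝ}
    (hx : x ∈ closure (openTriangle a b c)) (hx' : x ∉ openTriangle a b c) :
    x ∈ segment ℝ a b ∨ x ∈ segment ℝ b c ∨ x ∈ segment ℝ a c := by
  have hne : (openTriangle a b c).Nonempty := closure_nonempty_iff.1 ⟨x, hx⟩
  rw [closure_openTriangle hne, mem_convexHull_triple] at hx
  obtain ⟨r, s, t, hr, hs, ht, hsum, rfl⟩ := hx
  rcases hr.eq_or_lt with rfl | hr
  · exact Or.inr (Or.inl ⟨s, t, hs, ht, by linarith, by simp⟩)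
  rcases hs.eq_or_lt with rfl | hs
  · exact Or.inr (Or.inr ⟨r, t, hr.le, ht, by linarith, by simp⟩)
  rcases ht.eq_or_lt with rfl | ht
  · exact Or.inl ⟨r, s, hr.le, hs.le, by linarith, by simp⟩
  exfalso
  obtain ⟨y, hy⟩ := hne
  obtain ⟨r', s', t', hr', hs', ht', hsum', hy'⟩ :=
    mem_convexHull_triple.1 (interior_subset hy)
  obtain ⟨δ, hδ, hδr, hδs, hδt⟩ : ∃ δ > 0, δ < r ∧ δ < s ∧ δ < t := by
    obtain ⟨δ, hδ, h⟩ := exists_between (lt_min hr (lt_min hs ht))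
    exact ⟨δ, hδ, by simpa using h⟩
  have hδ1 : 0 < 1 - δ := by linarith
  have hz : ((r - δ * r') / (1 - δ)) • a + ((s - δ * s') / (1 - δ)) • b
      + ((t - δ * t') / (1 - δ)) • c ∈ convexHull ℝ ({a, b, c} : Set (ℝ × ℝ)) :=
    mem_convexHull_triple.2 ⟨_, _, _, div_nonneg (by nlinarith) hδ1.le,
      div_nonneg (by nlinarith) hδ1.le, div_nonneg (by nlinarith) hδ1.le,
      by field_simp; linear_combination hsum - δ * hsum', rfl⟩
  have hcombo := (convex_convexHull ℝ ({a, b, c} : Set (ℝ × ℝ))).combo_interior_self_mem_interior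
    hy hz hδ hδ1.le (by ring)
  have heq : δ • y + (1 - δ) • (((r - δ * r') / (1 - δ)) • a + ((s - δ * s') / (1 - δ)) • b
      + ((t - δ * t') / (1 - δ)) • c) = r • a + s • b + t • c := by
    rw [← hy']
    simp only [smul_add, smul_smul, mul_div_cancel₀ _ hδ1.ne']
    module
  rw [heq] at hcombo
  exact hx' hcombo

theorem openTriangle_rotate (a b c : ℝ × ℝ) : openTriangle a b c = openTriangle b c a := by
  unfold openTriangle
  congr 2
  ext
  simp only [Set.mem_insert_iff, Set.mem_singleton_iff]
  tauto

theorem openTriangle_swap (a b c : ℝ × ℝ) : openTriangle a b c = openTriangle b a c := by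
  unfold openTriangle
  congr 2
  ext
  simp only [Set.mem_insert_iff, Set.mem_singleton_iff]
  tauto

theorem IsEmbedded.pair_eq_side (hE : G.IsEmbedded) {a b c p q : ℝ × ℝ} (hab : G.Adj a b)
    (hbc : G.Adj b c) (hac : G.Adj a c) (hF : G.IsFace (openTriangle a b c))
    (hpq : G.Adj p q) (hm : midpoint ℝ p q ∈ closure (openTriangle a b c)) :
    ({p, q} : Set (ℝ × ℝ)) = {a, b} ∨ ({p, q} : Set (ℝ × ℝ)) = {b, c} ∨
      ({p, q} : Set (ℝ × ℝ)) = {a, c} :=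
  (mem_side_of_mem_closure_openTriangle hm fun h =>
      (hF.eq_connectedComponentIn h).1 (midpoint_mem_drawing hpq)).imp
    (hE.pair_eq_of_midpoint_mem hpq hab)
    (Or.imp (hE.pair_eq_of_midpoint_mem hpq hbc) (hE.pair_eq_of_midpoint_mem hpq hac))

/-- A bounded face bordering the edge `pq` is a triangle of the graph with `pq` as a side. -/
theorem IsNearTriangulation.exists_third_vertex (hG : G.IsNearTriangulation)
    {F : Set (ℝ × ℝ)} (hF : G.IsFace F) (hFb : IsBounded F) {p q : ℝ × ℝ} (hpq : G.Adj p q)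
    (hm : midpoint ℝ p q ∈ closure F) :
    ∃ r, G.Adj p r ∧ G.Adj q r ∧ F = openTriangle p q r := by
  obtain ⟨a, -, b, -, c, -, hab, hbc, hac, rfl⟩ := hG.2.2 F hF hFb
  have hsymm := G.symm
  rcases hG.1.pair_eq_side hab hbc hac hF hpq hm with h | h | h <;>
    rcases Set.pair_eq_pair_iff.1 h with ⟨rfl, rfl⟩ | ⟨rfl, rfl⟩
  · exact ⟨c, hac, hbc, rfl⟩
  · exact ⟨c, hbc, hac, openTriangle_swap _ _ _⟩
  · exact ⟨a, hsymm _ _ hab, hsymm _ _ hac, openTriangle_rotate _ _ _⟩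
  · exact ⟨a, hsymm _ _ hac, hsymm _ _ hab, by rw [openTriangle_rotate, openTriangle_swap]⟩
  · exact ⟨b, hab, hsymm _ _ hbc, by rw [openTriangle_swap, openTriangle_rotate]⟩
  · exact ⟨b, hsymm _ _ hbc, hab, (openTriangle_rotate _ _ _).symm⟩

theorem IsFace.midpoint_mem_closure {a b c : ℝ × ℝ} (hF : G.IsFace (openTriangle a b c)) :
    midpoint ℝ a b ∈ closure (openTriangle a b c) := by
  have hne : (openTriangle a b c).Nonempty := by
    obtain ⟨x, hx, h⟩ := hF
    exact h ▸ ⟨x, mem_connectedComponentIn hx⟩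
  rw [closure_openTriangle hne]
  refine segment_subset_convexHull (by simp) (by simp) (midpoint_mem_segment a b)

/-- In a hexagon each of whose sides carries a triangle, no two of these triangles being
consecutive ears, vertex `0` or `1` belongs to a dominating pair. -/
theorem exists_dominating_pair_zero {A : ZMod 6 → ZMod 6 → Prop}
    (hsymm : ∀ i j, A i j → A j i) (hirr : ∀ i, ¬ A i i) (hcyc : ∀ i, A i (i + 1))
    {apex : ZMod 6 → ZMod 6} (hapex : ∀ i, A i (apex i) ∧ A (i + 1) (apex i))
    (hears : ∀ i, apex i = i + 2 → apex (i + 2) ≠ i + 1) :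
    ∃ a b, a ≠ b ∧ (∀ v, A v a ∨ A v b) ∧ (a = 0 ∨ a = 1) := by
  have cases6 : ∀ w : ZMod 6, w = 0 ∨ w = 1 ∨ w = 2 ∨ w = 3 ∨ w = 4 ∨ w = 5 := by decide
  have h01 : A 0 1 := hcyc 0
  have h12 : A 1 2 := hcyc 1
  have h23 : A 2 3 := hcyc 2
  have h34 : A 3 4 := hcyc 3
  have h45 : A 4 5 := hcyc 4
  have h50 : A 5 0 := hcyc 5
  have h0 : A 0 (apex 0) ∧ A 1 (apex 0) := hapex 0
  have h2 : A 2 (apex 2) ∧ A 3 (apex 2) := hapex 2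
  have h4 : A 4 (apex 4) ∧ A 5 (apex 4) := hapex 4
  have e0 : apex 0 = 2 → apex 2 ≠ 1 := hears 0
  have e4 : apex 4 = 0 → apex 0 ≠ 5 := hears 4
  have pair : ∀ a b, a ≠ b → (a = 0 ∨ a = 1) → (A 0 a ∨ A 0 b) → (A 1 a ∨ A 1 b) →
      (A 2 a ∨ A 2 b) → (A 3 a ∨ A 3 b) → (A 4 a ∨ A 4 b) → (A 5 a ∨ A 5 b) →
      ∃ a b, a ≠ b ∧ (∀ v, A v a ∨ A v b) ∧ (a = 0 ∨ a = 1) := by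
    intro a b hab ha v0 v1 v2 v3 v4 v5
    refine ⟨a, b, hab, fun v => ?_, ha⟩
    rcases cases6 v with rfl | rfl | rfl | rfl | rfl | rfl <;> assumption
  rcases cases6 (apex 0) with x0 | x0 | x0 | x0 | x0 | x0 <;> rw [x0] at h0
  · exact absurd h0.1 (hirr 0)
  · exact absurd h0.2 (hirr 1)
  · rcases cases6 (apex 2) with x2 | x2 | x2 | x2 | x2 | x2 <;> rw [x2] at h2
    · refine pair 0 3 (by decide) (by decide) ?_ ?_ ?_ ?_ ?_ ?_ <;> clear pair <;> grind
    · exact absurd x2 (e0 x0)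
    · exact absurd h2.1 (hirr 2)
    · exact absurd h2.2 (hirr 3)
    · refine pair 0 2 (by decide) (by decide) ?_ ?_ ?_ ?_ ?_ ?_ <;> clear pair <;> grind
    · refine pair 0 5 (by decide) (by decide) ?_ ?_ ?_ ?_ ?_ ?_ <;> clear pair <;> grind
  · refine pair 0 3 (by decide) (by decide) ?_ ?_ ?_ ?_ ?_ ?_ <;> clear pair <;> grind
  · refine pair 1 4 (by decide) (by decide) ?_ ?_ ?_ ?_ ?_ ?_ <;> clear pair <;> grind
  · rcases cases6 (apex 4) with x4 | x4 | x4 | x4 | x4 | x4 <;> rw [x4] at h4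
    · exact absurd x0 (e4 x4)
    · refine pair 1 4 (by decide) (by decide) ?_ ?_ ?_ ?_ ?_ ?_ <;> clear pair <;> grind
    · refine pair 1 2 (by decide) (by decide) ?_ ?_ ?_ ?_ ?_ ?_ <;> clear pair <;> grind
    · refine pair 1 5 (by decide) (by decide) ?_ ?_ ?_ ?_ ?_ ?_ <;> clear pair <;> grind
    · exact absurd h4.1 (hirr 4)
    · exact absurd h4.2 (hirr 5)

theorem exists_dominating_pair {A : ZMod 6 → ZMod 6 → Prop} (hsymm : ∀ i j, A i j → A j i)
    (hirr : ∀ i, ¬ A i i) (hcyc : ∀ i, A i (i + 1)) {apex : ZMod 6 → ZMod 6}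
    (hapex : ∀ i, A i (apex i) ∧ A (i + 1) (apex i))
    (hears : ∀ i, apex i = i + 2 → apex (i + 2) ≠ i + 1) (i : ZMod 6) :
    ∃ a b, a ≠ b ∧ (∀ v, A v a ∨ A v b) ∧ (a = i ∨ a = i + 1) := by
  obtain ⟨a, b, hab, hdom, ha⟩ := exists_dominating_pair_zero
    (A := fun x y => A (i + x) (i + y)) (apex := fun x => apex (i + x) - i)
    (fun _ _ => hsymm _ _) (fun _ => hirr _)
    (fun x => by simpa only [add_assoc] using hcyc (i + x))
    (fun x => by simpa only [add_assoc, add_sub_cancel] using hapex (i + x))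
    (fun x h h' => hears (i + x) (by linear_combination h)
      (by rw [add_assoc]; linear_combination h'))
  refine ⟨i + a, i + b, by simpa using hab, fun v => ?_, ?_⟩
  · simpa only [add_sub_cancel] using hdom (v - i)
  · rcases ha with rfl | rfl <;> simp

/-- Each boundary edge of a near-triangulation whose boundary cycle is spanning lies on a
triangle of the graph, and no two of the chosen triangles are consecutive ears. -/
theorem IsNearTriangulation.exists_apex (hG : G.IsNearTriangulation) {u : ZMod 6 → ℝ × ℝ}
    (hu : G.IsBoundaryCycle u) (hmop : ∀ v ∈ G.verts, v ∈ Set.range u) :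
    ∃ apex : ZMod 6 → ZMod 6,
      (∀ i, G.Adj (u i) (u (apex i)) ∧ G.Adj (u (i + 1)) (u (apex i))) ∧
      ∀ i, apex i = i + 2 → apex (i + 2) ≠ i + 1 := by
  obtain ⟨-, hinj, -, hadj, hout, -⟩ := hu
  have hE := hG.1
  have hsimple : ∀ i j : ZMod 6, j ≠ i →
      ({u i, u (i + 1)} : Set (ℝ × ℝ)) ≠ {u j, u (j + 1)} := by
    intro i j hj h
    have hj2 : ∀ i j : ZMod 6, i = j + 1 → i + 1 ≠ j := by decide
    rcases Set.pair_eq_pair_iff.1 h with ⟨h1, -⟩ | ⟨h1, h2⟩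
    · exact hj (hinj h1).symm
    · exact hj2 i j (hinj h1) (hinj h2)
  have hface := fun i => hE.existsUnique_face hadj (hsimple i) (hout i)
  choose F hF huniq using hface
  have hthird : ∀ i, ∃ k, G.Adj (u i) (u k) ∧ G.Adj (u (i + 1)) (u k) ∧
      F i = openTriangle (u i) (u (i + 1)) (u k) := by
    intro i
    obtain ⟨r, h1, h2, h3⟩ := hG.exists_third_vertex (hF i).1 (hF i).2.1 (hadj i) (hF i).2.2
    obtain ⟨k, rfl⟩ := hmop r (G.mem_of_adj _ _ h1).2
    exact ⟨k, h1, h2, h3⟩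
  choose apex h1 h2 h3 using hthird
  refine ⟨apex, fun i => ⟨h1 i, h2 i⟩, fun i hi hi2 => ?_⟩
  have e1 : i + 1 + 1 = i + 2 := by ring
  have hFi : F i = openTriangle (u (i + 1)) (u (i + 2)) (u i) := by
    rw [h3, hi, openTriangle_rotate]
  have hFi2 : F (i + 2) = openTriangle (u (i + 1)) (u (i + 2)) (u (i + 2 + 1)) := by
    rw [h3, hi2, ← openTriangle_rotate]
  have hshare : ∀ j, ∀ c, F j = openTriangle (u (i + 1)) (u (i + 2)) c → F j = F (i + 1) := by
    intro j c hj
    refine huniq (i + 1) _ ⟨(hF j).1, (hF j).2.1, ?_⟩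
    have := (hF j).1
    rw [hj] at this ⊢
    rw [e1]
    exact this.midpoint_mem_closure
  have heq : F (i + 2) = F i := (hshare _ _ hFi2).trans (hshare _ _ hFi).symm
  have hm := (hF (i + 2)).2.2
  have hf := (hF i).1
  have hs1 := h1 i
  have hs2 := hadj (i + 1)
  rw [heq, h3, hi] at hm
  rw [h3, hi] at hf
  rw [hi] at hs1
  rw [e1] at hs2
  have hmem : u (i + 2 + 1) ∈ ({u (i + 2), u (i + 2 + 1)} : Set (ℝ × ℝ)) := by simp
  have hne : ∀ i : ZMod 6, i + 2 + 1 ≠ i ∧ i + 2 + 1 ≠ i + 1 ∧ i + 2 + 1 ≠ i + 2 := by decide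
  obtain ⟨n1, n2, n3⟩ := hne i
  rcases hE.pair_eq_side (hadj i) hs2 hs1 hf (hadj (i + 2)) hm with h | h | h <;>
    · rw [h] at hmem
      simp only [Set.mem_insert_iff, Set.mem_singleton_iff, hinj.eq_iff] at hmem
      tauto

end PlaneGraph

/-- Let `T` be a maximal outerplanar graph of order 6 with boundary cycle
`C = (u_1, …, u_6, u_1)`.  Then for every pair `u_i, u_{i+1}` of consecutive vertices of `C`,
there exists a total dominating set of `T` of size 2 containing `u_i` or `u_{i+1}`. -/
theorem MOP_order_six_TDS_of_size_two (T : PlaneGraph) (u : ZMod 6 → ℝ × ℝ)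
    (hT : T.IsNearTriangulation) (hu : T.IsBoundaryCycle u)
    (hmop : ∀ v ∈ T.verts, v ∈ Set.range u) (hcard : T.verts.card = 6) (i : ZMod 6) :
    ∃ D : Finset (ℝ × ℝ), T.IsTDS D ∧ D.card = 2 ∧ (u i ∈ D ∨ u (i + 1) ∈ D) := by
  obtain ⟨apex, hapex, hears⟩ := hT.exists_apex hu hmop
  obtain ⟨a, b, hab, hdom, ha⟩ := PlaneGraph.exists_dominating_pair
    (A := fun i j => T.Adj (u i) (u j)) (fun _ _ => T.symm _ _) (fun _ => T.loopless _)
    hu.2.2.2.1 hapex hears i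
  obtain ⟨-, hinj, hverts, -⟩ := hu
  refine ⟨{u a, u b}, ⟨?_, ?_⟩, Finset.card_pair (hinj.ne hab), ?_⟩
  · simp [Finset.insert_subset_iff, hverts]
  · intro v hv
    obtain ⟨j, rfl⟩ := hmop v hv
    simpa using hdom j
  · rcases ha with rfl | rfl <;> simp
end
end

section
/- Let T be a near-triangulation with boundary cycle C = (u_1, ..., u_h, u_1). If T is isomorphic to H_1 or H_2, then for every boundary vertex u_i, T has a total dominating set of size 5 containing u_i. -/
/-!
Common definitions.

A *plane graph* is a finite graph whose vertices are points of the plane `ℝ × ℝ` and whose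
edges are drawn as straight-line segments between their endpoints (by Fáry's theorem every
planar graph admits such a drawing).  A *near-triangulation* is a plane graph that is properly
embedded, biconnected, and all of whose bounded faces are triangles (the faces are the
connected components of the complement of the drawing).  The boundary cycle lists, cyclically,
the vertices on the outer (unbounded) face.
-/

open scoped Classical

noncomputable section

namespace PlaneGraph

/-- Every vertex of `H₁` lies in a total dominating set of size 5. -/
theorem H1graph_exists_totalDominating (w : Fin 12) :
    ∃ S : Finset (Fin 12), S.card = 5 ∧ w ∈ S ∧ ∀ v, ∃ d ∈ S, H1graph.Adj v d := by
  have key : ∀ w : Fin 12, ∃ S ∈ ([{0, 1, 5, 6, 11}, {1, 2, 7, 8, 9}, {3, 4, 5, 9, 10}] :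
      List (Finset (Fin 12))), S.card = 5 ∧ w ∈ S ∧
        ∀ v, ∃ d ∈ S, v ≠ d ∧ ((v, d) ∈ exc1Edges ∨ (d, v) ∈ exc1Edges) := by
    set_option synthInstance.maxSize 1000 in
    decide
  obtain ⟨S, -, hS⟩ := key w
  exact ⟨S, hS⟩

/-- Every vertex of `H₂` lies in a total dominating set of size 5. -/
theorem H2graph_exists_totalDominating (w : Fin 12) :
    ∃ S : Finset (Fin 12), S.card = 5 ∧ w ∈ S ∧ ∀ v, ∃ d ∈ S, H2graph.Adj v d := by
  have key : ∀ w : Fin 12, ∃ S ∈ ([{0, 1, 5, 6, 9}, {1, 2, 7, 8, 9}, {3, 4, 5, 10, 11}] :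
      List (Finset (Fin 12))), S.card = 5 ∧ w ∈ S ∧
        ∀ v, ∃ d ∈ S, v ≠ d ∧ ((v, d) ∈ exc2Edges ∨ (d, v) ∈ exc2Edges) := by
    set_option synthInstance.maxSize 1000 in
    decide
  obtain ⟨S, -, hS⟩ := key w
  exact ⟨S, hS⟩

/-- Total dominating sets pull back along an isomorphism. -/
theorem IsIsoToSG.exists_isTDS {G : PlaneGraph} {H : SimpleGraph (Fin 12)} (hG : G.IsIsoToSG H)
    {k : ℕ} (hH : ∀ w, ∃ S : Finset (Fin 12), S.card = k ∧ w ∈ S ∧ ∀ v, ∃ d ∈ S, H.Adj v d)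
    {p : ℝ × ℝ} (hp : p ∈ G.verts) :
    ∃ D : Finset (ℝ × ℝ), G.IsTDS D ∧ D.card = k ∧ p ∈ D := by
  obtain ⟨f, hf, hadj⟩ := hG
  obtain ⟨S, hcard, hpS, hdom⟩ := hH (f p)
  refine ⟨G.verts.filter (f · ∈ S), ⟨Finset.filter_subset _ _, fun v hv => ?_⟩, ?_,
    Finset.mem_filter.mpr ⟨hp, hpS⟩⟩
  · obtain ⟨d, hd, hvd⟩ := hdom (f v)
    obtain ⟨q, hq, rfl⟩ := hf.surjOn (Set.mem_univ d)
    exact ⟨q, Finset.mem_filter.mpr ⟨hq, hd⟩, (hadj v hv q hq).mpr hvd⟩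
  · rw [← hcard]
    refine Finset.card_nbij f (fun q hq => (Finset.mem_filter.mp hq).2)
      (hf.injOn.mono fun q hq => (Finset.mem_filter.mp hq).1) fun d hd => ?_
    obtain ⟨q, hq, rfl⟩ := hf.surjOn (Set.mem_univ d)
    exact ⟨q, Finset.mem_coe.mpr (Finset.mem_filter.mpr ⟨hq, hd⟩), rfl⟩

end PlaneGraph

/-- Let `T` be a near-triangulation with boundary cycle
`C = (u_1, …, u_h, u_1)`.  If `T` is isomorphic to `H₁` or `H₂`, then for every boundary
vertex `u_i`, `T` has a total dominating set of size 5 containing `u_i`. -/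
theorem TDS_of_exceptional (T : PlaneGraph) (h : ℕ) (u : ZMod h → ℝ × ℝ)
    (hT : T.IsNearTriangulation) (hu : T.IsBoundaryCycle u)
    (hexc : T.IsExceptional) (i : ZMod h) :
    ∃ D : Finset (ℝ × ℝ), T.IsTDS D ∧ D.card = 5 ∧ u i ∈ D := by
  exact hexc.elim
    (fun hiso => hiso.exists_isTDS PlaneGraph.H1graph_exists_totalDominating (hu.2.2.1 i))
    (fun hiso => hiso.exists_isTDS PlaneGraph.H2graph_exists_totalDominating (hu.2.2.1 i))
end
end
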